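/- arXiv:1507.00914 — 10 statements merged into one kernel-verified Lean document; each statement's English description precedes it below -/
import Mathlib

section
/- Let a ∈ F_q^× and let ψ, χ be multiplicative characters of F_q. Then Σ_{x∈F_q} ψ(x²)·χ(1 + a·x²) = ψ(−a^{−1})·J(ψ, χ) + (φψ)(−a^{−1})·J(φψ, χ), where φψ denotes the product character. -/
/-- The quadratic character of a finite field, as a `ℂ`-valued multiplicative character. -/
noncomputable def quadCharℂ (F : Type*) [Field F] [Fintype F] [DecidableEq F] : MulChar F ℂ :=
  (quadraticChar F).ringHomComp (Int.castRingHom ℂ)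

/-- A sum over squares, weighted by the number `φ(y) + 1` of square roots of each `y`. -/
theorem sum_comp_sq_eq_sum_quadCharℂ {F : Type*} [Field F] [Fintype F] [DecidableEq F]
    (hF : ringChar F ≠ 2) (f : F → ℂ) :
    ∑ x : F, f (x ^ 2) = ∑ y : F, (quadCharℂ F y + 1) * f y := by
  rw [← Finset.sum_fiberwise Finset.univ (fun x : F => x ^ 2)]
  refine Finset.sum_congr rfl fun y _ => ?_
  have hsum : ∑ x with x ^ 2 = y, f (x ^ 2) = ∑ x : F with x ^ 2 = y, f y :=
    Finset.sum_congr rfl fun x hx => by rw [(Finset.mem_filter.mp hx).2]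
  have hcard := congrArg (Int.cast : ℤ → ℂ) (quadraticChar_card_sqrts hF y)
  rw [Set.toFinset_ofPred] at hcard
  push_cast at hcard
  rw [hsum, Finset.sum_const, nsmul_eq_mul, hcard]
  rfl

/-- Rescaling the variable expresses a twisted sum through a Jacobi sum. -/
theorem sum_mul_one_add_mul_eq_jacobiSum {F R : Type*} [Field F] [Fintype F] [CommRing R]
    {a : F} (ha : a ≠ 0) (ψ χ : MulChar F R) :
    ∑ y : F, ψ y * χ (1 + a * y) = ψ (-a⁻¹) * jacobiSum ψ χ := by
  have hc : -a⁻¹ ≠ 0 := neg_ne_zero.mpr (inv_ne_zero ha)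
  rw [← Equiv.sum_comp (Equiv.mulLeft₀ (-a⁻¹) hc), jacobiSum, Finset.mul_sum]
  refine Finset.sum_congr rfl fun z _ => ?_
  have hz : 1 + a * (-a⁻¹ * z) = 1 - z := by
    field_simp
    ring
  rw [Equiv.mulLeft₀_apply, hz, map_mul, mul_assoc]

/-- Let `F = F_q` with `q` odd, `φ` the quadratic character, `a ∈ F_q^×` and
`ψ, χ` multiplicative characters of `F_q` (with values in `ℂ`, extended by `0` at `0`). Then
`∑_{x} ψ(x²)·χ(1 + a·x²) = ψ(−a⁻¹)·J(ψ,χ) + (φψ)(−a⁻¹)·J(φψ,χ)`, where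
`J(A,B) = ∑_x A(x)·B(1−x)` is the Jacobi sum. -/
theorem sum_sq_char_eq_jacobiSum
    {F : Type*} [Field F] [Fintype F] [DecidableEq F]
    (hq : Odd (Fintype.card F)) (a : F) (ha : a ≠ 0) (ψ χ : MulChar F ℂ) :
    ∑ x : F, ψ (x ^ 2) * χ (1 + a * x ^ 2) =
      ψ (-a⁻¹) * jacobiSum ψ χ +
        (quadCharℂ F * ψ) (-a⁻¹) * jacobiSum (quadCharℂ F * ψ) χ := by
  have hF : ringChar F ≠ 2 := fun h =>
    Nat.not_even_iff_odd.mpr hq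
      (Nat.even_iff.mpr (FiniteField.even_card_iff_char_two.mp h))
  rw [sum_comp_sq_eq_sum_quadCharℂ hF (fun y => ψ y * χ (1 + a * y)),
    ← sum_mul_one_add_mul_eq_jacobiSum ha, ← sum_mul_one_add_mul_eq_jacobiSum ha,
    ← Finset.sum_add_distrib]
  refine Finset.sum_congr rfl fun y _ => ?_
  rw [MulChar.mul_apply]
  ring
end

section
/- Let t be a positive integer, let m = 2^t, and suppose q ≡ 1 (mod m). Let ψ and χ be multiplicative characters of F_q, let χ_m be a multiplicative character of F_q of order m, and let a ∈ F_q^×. Then Σ_{x∈F_q} ψ(x^m)·χ(1 + a·x^m) = Σ_{k=0}^{m−1} (χ_m^k·ψ)(−a^{−1})·J(χ_m^k·ψ, χ). -/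
open Polynomial in
/-- The number of `m`-th roots of a nonzero `y` in a finite field is the sum of the values at `y`
of the powers of a multiplicative character of order `m`. -/
lemma card_filter_pow_eq_sum_mulChar_pow {F : Type*} [Field F] [Fintype F] [DecidableEq F]
    {m : ℕ} {χ : MulChar F ℂ} (hχ : orderOf χ = m) {y : F} (hy : y ≠ 0) :
    ((Finset.univ.filter fun x : F ↦ x ^ m = y).card : ℂ) =
      ∑ k ∈ Finset.range m, (χ ^ k) y := by
  have hm : 0 < m := hχ ▸ χ.orderOf_pos
  have hdvd : m ∣ Fintype.card Fˣ := by
    rw [Fintype.card_units, ← hχ]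
    exact χ.orderOf_dvd_card_sub_one
  obtain ⟨d, hd⟩ := hdvd
  obtain ⟨g, hg⟩ := IsCyclic.exists_generator (α := Fˣ)
  have hgord : orderOf g = Fintype.card Fˣ := orderOf_eq_card_of_forall_mem_zpowers hg |>.trans
    Nat.card_eq_fintype_card
  have hprim : IsPrimitiveRoot ((g ^ d : Fˣ) : F) m := by
    have h := IsPrimitiveRoot.orderOf g
    rw [hgord] at h
    exact (h.pow Fintype.card_pos (hd.trans (mul_comm _ _))).map_of_injective
      (f := Units.coeHom F) Units.val_injective
  have hcard : (Finset.univ.filter fun x : F ↦ x ^ m = y).card =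
      if ∃ α, α ^ m = y then m else 0 := by
    refine Eq.trans ?_ ((hprim.card_nthRoots y).trans (by congr))
    rw [← Multiset.toFinset_card_of_nodup (hprim.nthRoots_nodup hy)]
    congr 1
    ext x
    simp [mem_nthRoots hm]
  have hpow : (χ y) ^ m = 1 := by
    rw [← MulChar.pow_apply' χ hm.ne', ← hχ, pow_orderOf_eq_one, MulChar.one_apply hy.isUnit]
  have hsum : ∑ k ∈ Finset.range m, (χ ^ k) y = ∑ k ∈ Finset.range m, (χ y) ^ k :=
    Finset.sum_congr rfl fun k _ ↦ MulChar.pow_apply_coe χ k (Units.mk0 y hy)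
  rw [hcard, hsum]
  by_cases h1 : χ y = 1
  · have hex : ∃ α, α ^ m = y := by
      obtain ⟨j, hj⟩ := mem_powers_iff_mem_zpowers.mpr (hg (Units.mk0 y hy))
      have hj' : y = ((g ^ j : Fˣ) : F) := by simpa using (congrArg Units.val hj).symm
      have hχj : χ ^ j = 1 := by
        rw [MulChar.eq_iff hg, MulChar.pow_apply_coe, MulChar.one_apply_coe, ← map_pow,
          ← Units.val_pow_eq_pow_val, ← hj', h1]
      obtain ⟨e, rfl⟩ := hχ ▸ orderOf_dvd_of_pow_eq_one hχj
      exact ⟨((g ^ e : Fˣ) : F), by rw [hj']; push_cast; ring⟩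
    simp [hex, h1]
  · have hex : ¬ ∃ α, α ^ m = y := by
      rintro ⟨α, rfl⟩
      have hα : α ≠ 0 := by
        rintro rfl
        simp [hm.ne'] at hy
      exact h1 (by rw [map_pow, ← MulChar.pow_apply' χ hm.ne', ← hχ, pow_orderOf_eq_one,
        MulChar.one_apply hα.isUnit])
    rw [if_neg hex, geom_sum_eq h1, hpow]
    simp


/-- Let `F = F_q` with `q` odd, `m = 2ᵗ` with `t ≥ 1`, and suppose
`q ≡ 1 (mod m)`. Let `ψ, χ` be multiplicative characters of `F_q`, let `χ_m` be a
multiplicative character of order `m`, and let `a ∈ F_q^×`. Then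
`∑_{x} ψ(xᵐ)·χ(1 + a·xᵐ) = ∑_{k=0}^{m−1} (χ_mᵏ·ψ)(−a⁻¹)·J(χ_mᵏ·ψ, χ)`, where
`J(A,B) = ∑_x A(x)·B(1−x)` is the Jacobi sum. -/
theorem sum_pow_two_pow_char_eq_sum_jacobiSum
    {F : Type*} [Field F] [Fintype F] [DecidableEq F]
    (hq : Odd (Fintype.card F)) (t m : ℕ) (ht : 0 < t) (hm : m = 2 ^ t)
    (hqm : Fintype.card F % m = 1)
    (ψ χ χm : MulChar F ℂ) (hχm : orderOf χm = m)
    (a : F) (ha : a ≠ 0) :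
    ∑ x : F, ψ (x ^ m) * χ (1 + a * x ^ m) =
      ∑ k ∈ Finset.range m, (χm ^ k * ψ) (-a⁻¹) * jacobiSum (χm ^ k * ψ) χ := by
  have hm0 : 0 < m := hχm ▸ χm.orderOf_pos
  calc ∑ x : F, ψ (x ^ m) * χ (1 + a * x ^ m)
      = ∑ y : F, ((Finset.univ.filter fun x : F ↦ x ^ m = y).card : ℂ) *
          (ψ y * χ (1 + a * y)) := by
        rw [← Finset.sum_fiberwise Finset.univ (fun x : F ↦ x ^ m)]
        refine Finset.sum_congr rfl fun y _ ↦ ?_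
        rw [← nsmul_eq_mul, ← Finset.sum_const]
        refine Finset.sum_congr rfl fun x hx ↦ ?_
        rw [(Finset.mem_filter.mp hx).2]
    _ = ∑ y : F, ∑ k ∈ Finset.range m, (χm ^ k * ψ) y * χ (1 + a * y) := by
        refine Finset.sum_congr rfl fun y _ ↦ ?_
        rcases eq_or_ne y 0 with rfl | hy
        · simp [MulChar.map_zero]
        · rw [card_filter_pow_eq_sum_mulChar_pow hχm hy, Finset.sum_mul]
          simp only [MulChar.mul_apply, mul_assoc]
    _ = ∑ k ∈ Finset.range m, ∑ y : F, (χm ^ k * ψ) y * χ (1 + a * y) := Finset.sum_comm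
    _ = _ := by
        refine Finset.sum_congr rfl fun k _ ↦ ?_
        have ha' : -a⁻¹ ≠ 0 := neg_ne_zero.mpr (inv_ne_zero ha)
        rw [jacobiSum, Finset.mul_sum, ← Equiv.sum_comp (Equiv.mulLeft₀ (-a⁻¹) ha')]
        refine Finset.sum_congr rfl fun z _ ↦ ?_
        have hz : 1 + a * (-a⁻¹ * z) = 1 - z := by
          field_simp
          ring
        rw [Equiv.mulLeft₀_apply, hz, map_mul, mul_assoc]
end

section
/- Let m, n be positive integers, let a ∈ F_q^× and b ∈ F_q. Then ψ_{(m,n)}(a^m, b) = φ(a^{m+n})·ψ_{(m,n)}(1, b/a^n). -/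
/-- Let `F = F_q` with `q` odd and `φ` its quadratic character. For positive
integers `m, n`, `a ∈ F_q^×` and `b ∈ F_q`, one has
`ψ_{(m,n)}(aᵐ, b) = φ(a^{m+n})·ψ_{(m,n)}(1, b/aⁿ)`, where
`ψ_{(m,n)}(a,b) = ∑_x φ(xᵐ + a)·φ(xⁿ + b)`. -/
theorem psi_sum_scaling
    {F : Type*} [Field F] [Fintype F] [DecidableEq F]
    (hq : Odd (Fintype.card F)) (m n : ℕ) (hm : 0 < m) (hn : 0 < n)
    (a b : F) (ha : a ≠ 0) :
    (∑ x : F, ((quadraticChar F (x ^ m + a ^ m) : ℤ) : ℂ) *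
        ((quadraticChar F (x ^ n + b) : ℤ) : ℂ)) =
      ((quadraticChar F (a ^ (m + n)) : ℤ) : ℂ) *
        ∑ x : F, ((quadraticChar F (x ^ m + 1) : ℤ) : ℂ) *
          ((quadraticChar F (x ^ n + b / a ^ n) : ℤ) : ℂ) := by
  rw [← Equiv.sum_comp (Equiv.mulLeft₀ a ha), Finset.mul_sum]
  refine Finset.sum_congr rfl fun x _ => ?_
  have h₁ : (a * x) ^ m + a ^ m = a ^ m * (x ^ m + 1) := by ring
  have h₂ : (a * x) ^ n + b = a ^ n * (x ^ n + b / a ^ n) := by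
    rw [mul_add, mul_div_cancel₀ b (pow_ne_zero n ha), mul_pow]
  rw [Equiv.mulLeft₀_apply, h₁, h₂, pow_add]
  simp only [map_mul, Int.cast_mul]
  ring
end

section
/- Let p be an odd prime and let a, b ∈ F_p^× with a ≠ b. Then Σ_{x∈F_p} φ(x² + a)·φ(x² + b) = φ(−b)·Σ_{x∈F_p} φ(x·(x−1)·(x − a·b^{−1})) − 1. -/
section QuadraticCharSums

variable {F : Type*} [Field F] [Fintype F] [DecidableEq F]

/-- Summing `f` over all squares with multiplicity weights `f t` by `1 + φ(t)`. -/
theorem sum_comp_sq_eq_sum_quadraticChar_add_one (hF : ringChar F ≠ 2) (f : F → ℤ) :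
    ∑ x : F, f (x ^ 2) = ∑ t : F, (quadraticChar F t + 1) * f t := by
  rw [← Finset.sum_fiberwise_of_maps_to (g := fun x : F => x ^ 2) (t := Finset.univ)
    (fun _ _ => Finset.mem_univ _)]
  refine Finset.sum_congr rfl fun t _ => ?_
  rw [Finset.sum_congr rfl (g := fun _ => f t)
    (fun x hx => by rw [(Finset.mem_filter.mp hx).2]), Finset.sum_const, nsmul_eq_mul,
    ← quadraticChar_card_sqrts hF t]
  congr 3
  ext x
  simp

theorem sum_quadraticChar_add_mul_add (hF : ringChar F ≠ 2) {a b : F} (hab : a ≠ b) :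
    ∑ t : F, quadraticChar F ((t + a) * (t + b)) = -1 := by
  have hc : b - a ≠ 0 := sub_ne_zero.mpr hab.symm
  have hJ := jacobiSum_nontrivial_inv (quadraticChar_ne_one hF)
  rw [(quadraticChar_isQuadratic F).inv, jacobiSum] at hJ
  have hbij : Function.Bijective fun x : F => -(b - a) * x - a :=
    ((Equiv.mulLeft₀ _ (neg_ne_zero.mpr hc)).trans (Equiv.subRight a)).bijective
  rw [← hbij.sum_comp]
  have hterm (x : F) : quadraticChar F ((-(b - a) * x - a + a) * (-(b - a) * x - a + b)) =
      quadraticChar F (-1) * (quadraticChar F x * quadraticChar F (1 - x)) := by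
    rw [show (-(b - a) * x - a + a) * (-(b - a) * x - a + b) =
      (b - a) ^ 2 * (-1 * (x * (1 - x))) by ring, map_mul, quadraticChar_sq_one' hc, one_mul,
      map_mul, map_mul]
  simp only [hterm]
  rw [← Finset.mul_sum, hJ, mul_neg, ← sq, quadraticChar_sq_one (neg_ne_zero.mpr one_ne_zero)]

theorem sum_quadraticChar_mul_add_mul_add (a : F) {b : F} (hb : b ≠ 0) :
    ∑ t : F, quadraticChar F (t * ((t + a) * (t + b))) =
      quadraticChar F (-b) * ∑ x : F, quadraticChar F (x * (x - 1) * (x - a * b⁻¹)) := by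
  have hbij : Function.Bijective fun x : F => -b * x :=
    (Equiv.mulLeft₀ (-b) (neg_ne_zero.mpr hb)).bijective
  rw [← hbij.sum_comp, Finset.mul_sum]
  refine Finset.sum_congr rfl fun x _ => ?_
  rw [show -b * x * ((-b * x + a) * (-b * x + b)) =
    b ^ 2 * (-b * (x * (x - 1) * (x - a * b⁻¹))) by field_simp; ring, map_mul,
    quadraticChar_sq_one' hb, one_mul, map_mul]

theorem sum_quadraticChar_sq_add_mul_sq_add (hF : ringChar F ≠ 2) {a b : F} (hb : b ≠ 0)
    (hab : a ≠ b) :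
    ∑ x : F, quadraticChar F (x ^ 2 + a) * quadraticChar F (x ^ 2 + b) =
      quadraticChar F (-b) * ∑ x : F, quadraticChar F (x * (x - 1) * (x - a * b⁻¹)) - 1 := by
  rw [sum_comp_sq_eq_sum_quadraticChar_add_one hF
    fun t => quadraticChar F (t + a) * quadraticChar F (t + b)]
  simp only [← map_mul, add_mul, one_mul, Finset.sum_add_distrib]
  rw [← sum_quadraticChar_mul_add_mul_add a hb, sub_eq_add_neg,
    ← sum_quadraticChar_add_mul_add hF hab]
  simp only [add_mul]

end QuadraticCharSums

/-- Let `p` be an odd prime and `φ` the quadratic character of `F_p`. For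
`a, b ∈ F_p^×` with `a ≠ b` one has
`∑_{x ∈ F_p} φ(x² + a)·φ(x² + b) = φ(−b)·∑_{x ∈ F_p} φ(x·(x−1)·(x − a·b⁻¹)) − 1`. -/
theorem psi22_eq_elliptic_char_sum
    (p : ℕ) [Fact p.Prime] (hp : Odd p)
    (a b : ZMod p) (ha : a ≠ 0) (hb : b ≠ 0) (hab : a ≠ b) :
    (∑ x : ZMod p, ((quadraticChar (ZMod p) (x ^ 2 + a) : ℤ) : ℂ) *
        ((quadraticChar (ZMod p) (x ^ 2 + b) : ℤ) : ℂ)) =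
      ((quadraticChar (ZMod p) (-b) : ℤ) : ℂ) *
        (∑ x : ZMod p, ((quadraticChar (ZMod p) (x * (x - 1) * (x - a * b⁻¹)) : ℤ) : ℂ)) - 1 := by
  have hF : ringChar (ZMod p) ≠ 2 := by
    rw [ZMod.ringChar_zmod_n]
    rintro rfl
    exact absurd hp (by decide)
  exact_mod_cast sum_quadraticChar_sq_add_mul_sq_add hF hb hab
end

section
/- Let p ≡ 3 (mod 4) be an odd prime, let a ∈ F_p^×, and let b ∈ {−a, 2a, a·2^{−1}}. Then ψ_{(2,2)}(a,b) = Σ_{x∈F_p} φ(x² + a)·φ(x² + b) = −1. -/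
theorem sum_eq_zero_of_apply_sub_eq_neg {G : Type*} [AddCommGroup G] [Fintype G] {f : G → ℤ} (c : G)
    (hf : ∀ y, f (c - y) = -f y) :
    ∑ y, f y = 0 := by
  have h : ∑ y, f y = ∑ y, -f y :=
    (Fintype.sum_equiv (Equiv.subLeft c) _ _ fun y ↦ by simp [hf]).symm
  rw [Finset.sum_neg_distrib] at h
  omega

section QuadraticCharSums

variable {F : Type*} [Field F] [Fintype F] [DecidableEq F]

theorem sum_comp_sq_eq_sum_quadraticChar_add_one_mul (hF : ringChar F ≠ 2) (f : F → ℤ) :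
    ∑ x, f (x ^ 2) = ∑ y, (quadraticChar F y + 1) * f y := by
  rw [← Finset.sum_fiberwise Finset.univ (fun x : F ↦ x ^ 2)]
  refine Finset.sum_congr rfl fun y _ ↦ ?_
  rw [← quadraticChar_card_sqrts hF y, Finset.sum_congr rfl (g := fun _ ↦ f y) (by simp +contextual)]
  simp

theorem sum_quadraticChar_add_mul_quadraticChar_add (hF : ringChar F ≠ 2) {a b : F} (hab : a ≠ b) :
    ∑ y, quadraticChar F (y + a) * quadraticChar F (y + b) = -1 := by
  have hd : b - a ≠ 0 := sub_ne_zero.mpr hab.symm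
  calc ∑ y, quadraticChar F (y + a) * quadraticChar F (y + b)
      = ∑ z, quadraticChar F z * quadraticChar F (z + (b - a)) :=
        Fintype.sum_equiv (Equiv.addRight a) _ _ fun y ↦ by simp [add_assoc]
    _ = ∑ z, (quadraticChar F (1 + z⁻¹ * (b - a)) - if z = 0 then 1 else 0) := by
        refine Finset.sum_congr rfl fun z _ ↦ ?_
        rcases eq_or_ne z 0 with rfl | hz
        · simp
        · rw [if_neg hz, sub_zero, ← map_mul,
            show z * (z + (b - a)) = z ^ 2 * (1 + z⁻¹ * (b - a)) by field_simp, map_mul,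
            quadraticChar_sq_one' hz, one_mul]
    _ = ∑ z, quadraticChar F (1 + z⁻¹ * (b - a)) - 1 := by simp [Finset.sum_sub_distrib]
    _ = ∑ w, quadraticChar F w - 1 := by
        congr 1
        exact Fintype.sum_equiv
          ((Equiv.inv F).trans ((Equiv.mulRight₀ _ hd).trans (Equiv.addLeft 1))) _ _
          fun z ↦ by simp
    _ = -1 := by rw [quadraticChar_sum_zero hF]; simp

theorem sum_quadraticChar_sq_add_mul_quadraticChar_sq_add (hF : ringChar F ≠ 2)
    (hneg : quadraticChar F (-1) = -1) {a b : F} (hab : a ≠ b) (c : F)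
    (hc : ∀ y, (c - y) * (c - y + a) * (c - y + b) = -1 * (y * (y + a) * (y + b))) :
    ∑ x, quadraticChar F (x ^ 2 + a) * quadraticChar F (x ^ 2 + b) = -1 := by
  have hodd : ∑ y, quadraticChar F (y * (y + a) * (y + b)) = 0 :=
    sum_eq_zero_of_apply_sub_eq_neg c fun y ↦ by rw [hc, map_mul, hneg, neg_one_mul]
  rw [sum_comp_sq_eq_sum_quadraticChar_add_one_mul hF
    fun y ↦ quadraticChar F (y + a) * quadraticChar F (y + b)]
  simp only [map_mul, mul_assoc] at hodd
  simp only [add_mul, one_mul, Finset.sum_add_distrib, hodd, zero_add,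
    sum_quadraticChar_add_mul_quadraticChar_add hF hab]

end QuadraticCharSums


/-- Let `p ≡ 3 (mod 4)` be a prime, `φ` the quadratic character of `F_p`,
`a ∈ F_p^×` and `b ∈ {−a, 2a, a/2}`. Then
`ψ_{(2,2)}(a,b) = ∑_{x ∈ F_p} φ(x² + a)·φ(x² + b) = −1`. -/
theorem psi22_special_values_three_mod_four
    (p : ℕ) [Fact p.Prime] (hp : p % 4 = 3)
    (a b : ZMod p) (ha : a ≠ 0) (hb : b ∈ ({-a, 2 * a, a * 2⁻¹} : Set (ZMod p))) :
    (∑ x : ZMod p, ((quadraticChar (ZMod p) (x ^ 2 + a) : ℤ) : ℂ) *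
        ((quadraticChar (ZMod p) (x ^ 2 + b) : ℤ) : ℂ)) = -1 := by
  have hF : ringChar (ZMod p) ≠ 2 := by
    rw [ZMod.ringChar_zmod_n]
    omega
  have h2 : (2 : ZMod p) ≠ 0 := Ring.two_ne_zero hF
  have hneg : quadraticChar (ZMod p) (-1) = -1 := by
    rw [quadraticChar_neg_one hF, ZMod.card, ZMod.χ₄_nat_three_mod_four hp]
  suffices h : ∑ x : ZMod p, quadraticChar (ZMod p) (x ^ 2 + a) *
      quadraticChar (ZMod p) (x ^ 2 + b) = -1 by exact_mod_cast h
  rcases hb with rfl | rfl | rfl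
  · refine sum_quadraticChar_sq_add_mul_quadraticChar_sq_add hF hneg ?_ 0 fun y ↦ by ring
    intro h
    exact mul_ne_zero h2 ha (by linear_combination h)
  · refine sum_quadraticChar_sq_add_mul_quadraticChar_sq_add hF hneg ?_ (-2 * a) fun y ↦ by ring
    intro h
    exact ha (by linear_combination -h)
  · obtain ⟨d, rfl⟩ : ∃ d, a = 2 * d := ⟨a * 2⁻¹, by field_simp⟩
    rw [show 2 * d * 2⁻¹ = d by field_simp]
    refine sum_quadraticChar_sq_add_mul_quadraticChar_sq_add hF hneg ?_ (-2 * d) fun y ↦ by ring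
    intro h
    exact right_ne_zero_of_mul ha (by linear_combination h)
end

section
/- Let a, b ∈ F_q^× with a ≠ b. Then ψ_{(2,2)}(a,b) = Σ_{x∈F_q} φ(x² + a)·φ(x² + b) = q·φ(b)·₂F₁(φ, φ; ε | a/b) − 1, where ε is the trivial character. -/
/-- Greene's Gaussian hypergeometric series `₂F₁(A,B;C | x)` over the finite field `F`:
`₂F₁(A,B;C | x) = (C(−1)/(q(q−1))) · ∑_ψ J(Aψ, ψ⁻¹)·J(Bψ, C⁻¹ψ⁻¹)·ψ(x)`,
the sum running over all multiplicative characters `ψ` of `F`,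
where `J(A,B) = ∑_x A(x)·B(1−x)` is the Jacobi sum. -/
noncomputable def gauss2F1 {F : Type*} [Field F] [Fintype F]
    (A B C : MulChar F ℂ) (x : F) : ℂ :=
  haveI : Fintype (MulChar F ℂ) := Fintype.ofFinite _
  C (-1) / ((Fintype.card F : ℂ) * ((Fintype.card F : ℂ) - 1)) *
    ∑ ψ : MulChar F ℂ, jacobiSum (A * ψ) ψ⁻¹ * jacobiSum (B * ψ) (C⁻¹ * ψ⁻¹) * ψ x

namespace MulChar

/-- Orthogonality relation for the complex multiplicative characters of a finite field. -/
lemma sum_apply_eq_ite {F : Type*} [Field F] [Fintype F] [DecidableEq F]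
    [Fintype (MulChar F ℂ)] (z : F) :
    ∑ ψ : MulChar F ℂ, ψ z = if z = 1 then (Fintype.card F : ℂ) - 1 else 0 := by
  split_ifs with h
  · subst h
    have hcard : Fintype.card (MulChar F ℂ) + 1 = Fintype.card F := by
      rw [← Nat.card_eq_fintype_card, card_eq_card_units_of_hasEnoughRootsOfUnity,
        Nat.card_eq_fintype_card, Fintype.card_eq_card_units_add_one (α := F)]
    simp [← hcard]
  · obtain ⟨χ, hχ⟩ := exists_apply_ne_one_of_hasEnoughRootsOfUnity F ℂ h
    refine eq_zero_of_mul_eq_self_left hχ ?_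
    simp only [Finset.mul_sum, ← mul_apply]
    exact Fintype.sum_bijective _ (Group.mulLeft_bijective χ) _ _ fun _ ↦ rfl

end MulChar

lemma jacobiSum_mul_inv_eq_sum {F R : Type*} [Field F] [Fintype F] [CommRing R]
    (A ψ : MulChar F R) :
    jacobiSum (A * ψ) ψ⁻¹ = ∑ u : F, A⁻¹ (u + 1) * ψ⁻¹ u := by
  rw [jacobiSum, ← Equiv.sum_comp (Equiv.inv F), ← Equiv.sum_comp (Equiv.addRight (1 : F))]
  refine Finset.sum_congr rfl fun u _ ↦ ?_
  simp only [Equiv.coe_addRight, Equiv.inv_apply, MulChar.mul_apply, MulChar.inv_apply']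
  rcases eq_or_ne (u + 1) 0 with h | h
  · simp [h, MulChar.map_zero]
  · rw [mul_assoc, ← map_mul ψ]
    congr 2
    rw [← mul_inv, mul_sub, mul_one, mul_inv_cancel₀ h, add_sub_cancel_right]

/-- A single-sum formula for `₂F₁` with trivial lower parameter. -/
lemma gauss2F1_one_eq_sum {F : Type*} [Field F] [Fintype F]
    (A B : MulChar F ℂ) {x : F} (hx : x ≠ 0) :
    Fintype.card F * gauss2F1 A B 1 x =
      ∑ u : F, (1 : MulChar F ℂ) u * A⁻¹ (u + 1) * B⁻¹ (x / u + 1) := by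
  classical
  let : Fintype (MulChar F ℂ) := Fintype.ofFinite _
  have hq : (Fintype.card F : ℂ) ≠ 0 := Nat.cast_ne_zero.2 Fintype.card_ne_zero
  have hq' : (Fintype.card F : ℂ) - 1 ≠ 0 :=
    sub_ne_zero.2 (Nat.cast_ne_one.2 Fintype.one_lt_card.ne')
  have key : ∑ ψ : MulChar F ℂ, jacobiSum (A * ψ) ψ⁻¹ * jacobiSum (B * ψ) (1⁻¹ * ψ⁻¹) * ψ x =
      ((Fintype.card F : ℂ) - 1) *
        ∑ u : F, (1 : MulChar F ℂ) u * A⁻¹ (u + 1) * B⁻¹ (x / u + 1) := by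
    calc
      _ = ∑ u : F, ∑ v : F, A⁻¹ (u + 1) * B⁻¹ (v + 1) *
            ∑ ψ : MulChar F ℂ, ψ (u⁻¹ * v⁻¹ * x) := by
        simp only [inv_one, one_mul, jacobiSum_mul_inv_eq_sum, Finset.sum_mul_sum]
        simp only [Finset.sum_mul, Finset.mul_sum]
        rw [Finset.sum_comm]
        refine Finset.sum_congr rfl fun u _ ↦ ?_
        rw [Finset.sum_comm]
        refine Finset.sum_congr rfl fun v _ ↦ Finset.sum_congr rfl fun ψ _ ↦ ?_
        rw [MulChar.inv_apply' ψ, MulChar.inv_apply' ψ, map_mul, map_mul]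
        ring
      _ = _ := by
        rw [Finset.mul_sum]
        refine Finset.sum_congr rfl fun u _ ↦ ?_
        simp only [MulChar.sum_apply_eq_ite]
        rcases eq_or_ne u 0 with rfl | hu
        · simp [MulChar.map_zero]
        · have h (v : F) : u⁻¹ * v⁻¹ * x = 1 ↔ v = x / u := by
            rcases eq_or_ne v 0 with rfl | hv
            · simp [eq_comm, hx, hu]
            · field_simp
              exact eq_comm
          simp only [h, mul_ite, mul_zero, Finset.sum_ite_eq', Finset.mem_univ, if_true,
            MulChar.one_apply hu.isUnit]
          ring
  rw [gauss2F1, key, MulChar.one_apply isUnit_one.neg]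
  field_simp

section QuadraticCharacter

variable {F : Type*} [Field F] [Fintype F] [DecidableEq F]

lemma quadCharℂ_isQuadratic : (quadCharℂ F).IsQuadratic :=
  (quadraticChar_isQuadratic F).comp _

lemma quadCharℂ_mul_self {x : F} (hx : x ≠ 0) : quadCharℂ F x * quadCharℂ F x = 1 := by
  rw [← MulChar.mul_apply, ← sq, quadCharℂ_isQuadratic.sq_eq_one, MulChar.one_apply hx.isUnit]

lemma quadCharℂ_ne_one (hF : ringChar F ≠ 2) : quadCharℂ F ≠ 1 :=
  (MulChar.ringHomComp_ne_one_iff (Int.cast_injective (α := ℂ))).2 (quadraticChar_ne_one hF)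

lemma quadCharℂ_div (x y : F) : quadCharℂ F (x / y) = quadCharℂ F x * quadCharℂ F y := by
  rw [div_eq_mul_inv, map_mul, ← MulChar.inv_apply', quadCharℂ_isQuadratic.inv]

lemma sum_quadCharℂ_add_mul_add (hF : ringChar F ≠ 2) {a b : F} (hab : a ≠ b) :
    ∑ t : F, quadCharℂ F (t + a) * quadCharℂ F (t + b) = -1 := by
  have hc : a - b ≠ 0 := sub_ne_zero.2 hab
  have hJ := jacobiSum_nontrivial_inv (quadCharℂ_ne_one hF)
  rw [quadCharℂ_isQuadratic.inv, jacobiSum] at hJ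
  calc
    _ = ∑ x : F, quadCharℂ F (-1) * (quadCharℂ F x * quadCharℂ F (1 - x)) := by
      rw [← ((Equiv.mulLeft₀ (a - b) hc).trans (Equiv.subRight a)).sum_comp]
      refine Finset.sum_congr rfl fun x _ ↦ ?_
      simp only [Equiv.trans_apply, Equiv.mulLeft₀_apply, Equiv.subRight_apply]
      rw [show (a - b) * x - a + a = (a - b) * x by ring,
        show (a - b) * x - a + b = (a - b) * (-1 * (1 - x)) by ring, map_mul, map_mul, map_mul]
      linear_combination (quadCharℂ F (-1) * quadCharℂ F x * quadCharℂ F (1 - x)) *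
        quadCharℂ_mul_self hc
    _ = -1 := by
      rw [← Finset.mul_sum, hJ, mul_neg, quadCharℂ_mul_self (neg_ne_zero.2 one_ne_zero)]

lemma sum_comp_sq (hF : ringChar F ≠ 2) (f : F → ℂ) :
    ∑ x : F, f (x ^ 2) = ∑ t : F, (1 + quadCharℂ F t) * f t := by
  rw [← Finset.sum_fiberwise Finset.univ (fun x : F ↦ x ^ 2)]
  refine Finset.sum_congr rfl fun t _ ↦ ?_
  have hcard : ((Finset.univ.filter fun x : F ↦ x ^ 2 = t).card : ℤ) = quadraticChar F t + 1 := by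
    rw [← quadraticChar_card_sqrts hF t]
    congr 2
    ext
    simp
  rw [Finset.sum_congr rfl fun x hx ↦ by rw [(Finset.mem_filter.1 hx).2], Finset.sum_const,
    nsmul_eq_mul, ← Int.cast_natCast (R := ℂ), hcard]
  simp [quadCharℂ, add_comm]

lemma quadCharℂ_mul_gauss2F1_eq_sum {a b : F} (ha : a ≠ 0) (hb : b ≠ 0) :
    Fintype.card F * quadCharℂ F b * gauss2F1 (quadCharℂ F) (quadCharℂ F) 1 (a / b) =
      ∑ t : F, quadCharℂ F t * (quadCharℂ F (t + a) * quadCharℂ F (t + b)) := by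
  rw [mul_right_comm, gauss2F1_one_eq_sum _ _ (div_ne_zero ha hb), quadCharℂ_isQuadratic.inv,
    Finset.sum_mul, ← Equiv.sum_comp (Equiv.divRight₀ b hb)]
  refine Finset.sum_congr rfl fun t _ ↦ ?_
  simp only [Equiv.divRight₀_apply]
  rcases eq_or_ne t 0 with rfl | ht
  · simp [MulChar.map_zero]
  · rw [MulChar.one_apply (div_ne_zero ht hb).isUnit,
      show t / b + 1 = (t + b) / b by field_simp,
      show a / b / (t / b) + 1 = (t + a) / t by field_simp; ring, quadCharℂ_div, quadCharℂ_div]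
    linear_combination (quadCharℂ F (t + a) * quadCharℂ F (t + b) * quadCharℂ F t) *
      quadCharℂ_mul_self hb

end QuadraticCharacter

/-- Let `F = F_q` with `q` odd and `φ` its quadratic character. For
`a, b ∈ F_q^×` with `a ≠ b`, one has
`ψ_{(2,2)}(a,b) = ∑_x φ(x² + a)·φ(x² + b) = q·φ(b)·₂F₁(φ,φ;ε | a/b) − 1`,
where `ε` is the trivial character. -/
theorem psi22_eq_hypergeometric
    {F : Type*} [Field F] [Fintype F] [DecidableEq F]
    (hq : Odd (Fintype.card F)) (a b : F) (ha : a ≠ 0) (hb : b ≠ 0) (hab : a ≠ b) :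
    (∑ x : F, (quadCharℂ F) (x ^ 2 + a) * (quadCharℂ F) (x ^ 2 + b)) =
      (Fintype.card F : ℂ) * (quadCharℂ F) b *
        gauss2F1 (quadCharℂ F) (quadCharℂ F) (1 : MulChar F ℂ) (a / b) - 1 := by
  have hF : ringChar F ≠ 2 := fun h ↦
    Nat.not_even_iff_odd.2 hq (Nat.even_iff.2 (FiniteField.even_card_of_char_two h))
  rw [quadCharℂ_mul_gauss2F1_eq_sum ha hb,
    sum_comp_sq hF fun t ↦ quadCharℂ F (t + a) * quadCharℂ F (t + b)]
  simp only [add_mul, one_mul, Finset.sum_add_distrib, sum_quadCharℂ_add_mul_add hF hab]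
  ring
end

section
/- Let m be a positive integer with q ≡ 1 (mod 2m), let a, b ∈ F_q^×, and let χ be a multiplicative character of F_q of order 2m. Then ψ_{(m,m)}(a,b) = φ(a)·φ(b) + Σ_{x∈F_q} φ(x+a)·φ(x+b)·(Σ_{k=0}^{m−1} χ^{2k}(x)), where every multiplicative character (including the trivial character χ^0) is extended by the value 0 at x = 0. -/
/-- A multiplicative character of a finite field takes at a generator of the unit group a value
which is a primitive root of unity of the order of the character. -/
lemma MulChar.isPrimitiveRoot_apply_generator {F R : Type*} [Field F] [Fintype F]
    [CommRing R] (ψ : MulChar F R) {g : Fˣ} (hg : ∀ x, x ∈ Subgroup.zpowers g) :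
    IsPrimitiveRoot (ψ g) (orderOf ψ) := by
  refine ⟨?_, fun l hl ↦ ?_⟩
  · rw [← MulChar.pow_apply_coe, pow_orderOf_eq_one, MulChar.one_apply_coe]
  · refine orderOf_dvd_of_pow_eq_one ((MulChar.eq_iff hg _ _).mpr ?_)
    rw [MulChar.pow_apply_coe, hl, MulChar.one_apply_coe]

/-- A unit of a finite field is a power with exponent `orderOf ψ` iff `ψ` is trivial on it. -/
lemma MulChar.exists_pow_orderOf_eq_iff {F R : Type*} [Field F] [Fintype F] [CommRing R]
    (ψ : MulChar F R) {y : F} (hy : y ≠ 0) :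
    (∃ x : F, x ^ orderOf ψ = y) ↔ ψ y = 1 := by
  constructor
  · rintro ⟨x, rfl⟩
    have hx : IsUnit x := by
      refine IsUnit.mk0 x fun hx ↦ hy ?_
      rw [hx, zero_pow (orderOf_pos ψ).ne']
    rw [map_pow, ← hx.unit_spec, ← MulChar.pow_apply_coe, pow_orderOf_eq_one,
      MulChar.one_apply_coe]
  · intro h
    obtain ⟨g, hg⟩ := IsCyclic.exists_generator (α := Fˣ)
    obtain ⟨j, hj⟩ := mem_powers_iff_mem_zpowers.mpr (hg (Units.mk0 y hy))
    have hj' : (g : F) ^ j = y := by simpa using congrArg Units.val hj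
    rw [← hj', map_pow, (ψ.isPrimitiveRoot_apply_generator hg).pow_eq_one_iff_dvd] at h
    obtain ⟨c, rfl⟩ := h
    exact ⟨(g : F) ^ c, by rw [← hj', ← pow_mul, mul_comm]⟩

/-- The number of roots of `x ^ n = y` in a finite field, for `n` the order of a character `ψ`,
is the sum of the values at `y` of the powers of `ψ`, corrected at `y = 0`. -/
lemma MulChar.card_pow_orderOf_eq {F R : Type*} [Field F] [Fintype F] [DecidableEq F]
    [CommRing R] [IsDomain R] (ψ : MulChar F R) (y : F) :
    ((Finset.univ.filter fun x : F ↦ x ^ orderOf ψ = y).card : R) =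
      (if y = 0 then 1 else 0) + ∑ k ∈ Finset.range (orderOf ψ), (ψ ^ k) y := by
  have hn : 0 < orderOf ψ := orderOf_pos ψ
  rcases eq_or_ne y 0 with rfl | hy
  · have h0 : (Finset.univ.filter fun x : F ↦ x ^ orderOf ψ = 0) = {0} := by
      ext x
      simp [pow_eq_zero_iff hn.ne']
    rw [h0]
    simp
  have hsum : ∑ k ∈ Finset.range (orderOf ψ), (ψ ^ k) y =
      ∑ k ∈ Finset.range (orderOf ψ), ψ y ^ k := by
    refine Finset.sum_congr rfl fun k _ ↦ ?_
    simpa using MulChar.pow_apply_coe ψ k (Units.mk0 y hy)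
  obtain ⟨g, hg⟩ := IsCyclic.exists_generator (α := Fˣ)
  obtain ⟨c, hc⟩ := MulChar.orderOf_dvd_card_sub_one F ψ
  have hord : orderOf g = c * orderOf ψ := by
    rw [orderOf_eq_card_of_forall_mem_zpowers hg, Nat.card_eq_fintype_card, Fintype.card_units,
      hc, mul_comm]
  have hζ : IsPrimitiveRoot ((g : F) ^ c) (orderOf ψ) :=
    (IsPrimitiveRoot.coe_units_iff.mpr (IsPrimitiveRoot.orderOf g)).pow (_root_.orderOf_pos g) hord
  have hfib : (Finset.univ.filter fun x : F ↦ x ^ orderOf ψ = y) =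
      (Polynomial.nthRoots (orderOf ψ) y).toFinset := by
    ext x
    simp [Polynomial.mem_nthRoots hn]
  rw [hfib, Multiset.toFinset_card_of_nodup (hζ.nthRoots_nodup hy), hζ.card_nthRoots, hsum,
    if_neg hy, zero_add]
  split_ifs with hex
  · simp [(ψ.exists_pow_orderOf_eq_iff hy).mp hex]
  · have h : ψ y ≠ 1 := mt (ψ.exists_pow_orderOf_eq_iff hy).mpr hex
    have hpow : ψ y ^ orderOf ψ = 1 := by
      have := MulChar.pow_apply_coe ψ (orderOf ψ) (Units.mk0 y hy)
      rw [pow_orderOf_eq_one, MulChar.one_apply_coe] at this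
      exact this.symm
    have hgeom := mul_geom_sum (ψ y) (orderOf ψ)
    rw [hpow, sub_self] at hgeom
    rw [(mul_eq_zero.mp hgeom).resolve_left (sub_ne_zero.mpr h), Nat.cast_zero]

/-- Let `F = F_q` with `q` odd, `φ` its quadratic character, `m ≥ 1` with
`q ≡ 1 (mod 2m)`, `a, b ∈ F_q^×`, and `χ` a multiplicative character of `F_q` of order `2m`
(every character, including the trivial one `χ⁰`, takes the value `0` at `0`). Then
`ψ_{(m,m)}(a,b) = φ(a)·φ(b) + ∑_{x ∈ F_q} φ(x+a)·φ(x+b)·(∑_{k=0}^{m−1} χ^{2k}(x))`. -/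
theorem psi_mm_eq_sum_over_characters
    {F : Type*} [Field F] [Fintype F] [DecidableEq F]
    (hq : Odd (Fintype.card F)) (m : ℕ) (hm : 0 < m)
    (hqm : Fintype.card F % (2 * m) = 1)
    (a b : F) (ha : a ≠ 0) (hb : b ≠ 0)
    (χ : MulChar F ℂ) (hχ : orderOf χ = 2 * m) :
    (∑ x : F, ((quadraticChar F (x ^ m + a) : ℤ) : ℂ) *
        ((quadraticChar F (x ^ m + b) : ℤ) : ℂ)) =
      ((quadraticChar F a : ℤ) : ℂ) * ((quadraticChar F b : ℤ) : ℂ) +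
        ∑ x : F, ((quadraticChar F (x + a) : ℤ) : ℂ) * ((quadraticChar F (x + b) : ℤ) : ℂ) *
          (∑ k ∈ Finset.range m, (χ ^ (2 * k)) x) := by
  have hψ : orderOf (χ ^ 2) = m := by
    rw [orderOf_pow_of_dvd two_ne_zero (hχ ▸ dvd_mul_right 2 m), hχ,
      Nat.mul_div_cancel_left m two_pos]
  have hcard (y : F) := MulChar.card_pow_orderOf_eq (χ ^ 2) y
  simp only [hψ, ← pow_mul] at hcard
  set f : F → ℂ := fun y ↦ ((quadraticChar F (y + a) : ℤ) : ℂ) *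
    ((quadraticChar F (y + b) : ℤ) : ℂ) with hf
  calc ∑ x : F, f (x ^ m)
      = ∑ y : F, ∑ x : F with x ^ m = y, f (x ^ m) :=
        (Finset.sum_fiberwise _ (fun x : F ↦ x ^ m) _).symm
    _ = ∑ y : F, f y * ((if y = 0 then 1 else 0) + ∑ k ∈ Finset.range m, (χ ^ (2 * k)) y) := by
        refine Finset.sum_congr rfl fun y _ ↦ ?_
        rw [← hcard, Finset.sum_congr rfl (g := fun _ ↦ f y), Finset.sum_const, nsmul_eq_mul,
          mul_comm]
        intro x hx
        rw [(Finset.mem_filter.mp hx).2]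
    _ = _ := by
        simp only [mul_add, Finset.sum_add_distrib]
        simp [hf]
end

section
/- Let m be a positive integer with q ≡ 1 (mod 2m), let a, b ∈ F_q^× with a ≠ b, and let χ be a multiplicative character of F_q of order 2m. Then ψ_{(m,m)}(a,b) = φ(ab) + q·φ(−ab)·Σ_{k=0}^{m−1} χ^{2k}(−a)·₂F₁(φ, χ^{2k}; χ^{2k+m} | a/b). -/
section MulCharSums

variable {F : Type*} [Field F] [Fintype F]

theorem MulChar.sum_apply_eq_zero [Fintype (MulChar F ℂ)] {a : F} (ha : a ≠ 1) :
    ∑ ψ : MulChar F ℂ, ψ a = 0 := by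
  obtain ⟨χ, hχ⟩ := MulChar.exists_apply_ne_one_of_hasEnoughRootsOfUnity F ℂ ha
  refine eq_zero_of_mul_eq_self_left hχ ?_
  simp only [Finset.mul_sum, ← MulChar.mul_apply]
  exact Fintype.sum_bijective _ (Group.mulLeft_bijective χ) _ _ fun χ' ↦ rfl

theorem MulChar.sum_apply [Fintype (MulChar F ℂ)] [DecidableEq F] (a : F) :
    ∑ ψ : MulChar F ℂ, ψ a = if a = 1 then (Fintype.card F : ℂ) - 1 else 0 := by
  split_ifs with ha
  · have h : Fintype.card (MulChar F ℂ) = Fintype.card Fˣ := by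
      simpa only [Nat.card_eq_fintype_card] using
        MulChar.card_eq_card_units_of_hasEnoughRootsOfUnity F ℂ
    simp [ha, h, Fintype.card_units, Nat.cast_sub Fintype.card_pos]
  · exact MulChar.sum_apply_eq_zero ha

/-- For `v ≠ 0, 1` and `x ≠ 0` the only possible solution `u` of
`(u / (1 - u)) * (v / (1 - v)) * x = 1` is `(1 - v) / (1 - v + x * v)`. -/
theorem sum_mulChar_ite_eq [DecidableEq F] (A : MulChar F ℂ) {v x : F} (hv : v ≠ 0)
    (hv1 : 1 - v ≠ 0) (hx : x ≠ 0) (c : ℂ) :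
    ∑ u : F, A u * (if u * (1 - u)⁻¹ * (v * (1 - v)⁻¹) * x = 1 then c else 0) =
      A (1 - v) * A⁻¹ (1 - v + x * v) * c := by
  have key (u : F) : u * (1 - u)⁻¹ * (v * (1 - v)⁻¹) * x = 1 ↔
      u = (1 - v) * (1 - v + x * v)⁻¹ ∧ 1 - v + x * v ≠ 0 := by
    rcases eq_or_ne (1 - u) 0 with hu | hu
    · have hu' : u = 1 := by linear_combination -hu
      subst hu'
      simp only [sub_self, inv_zero, mul_zero, zero_mul, zero_ne_one, false_iff, not_and]
      intro h h0
      rw [← div_eq_mul_inv, eq_div_iff h0] at h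
      exact mul_ne_zero hx hv (by linear_combination h)
    · have h1 : u * (1 - u)⁻¹ * (v * (1 - v)⁻¹) * x = 1 ↔ u * (1 - v + x * v) = 1 - v := by
        field_simp
        constructor <;> intro h <;> linear_combination h
      rw [h1]
      constructor
      · intro h
        have h0 : 1 - v + x * v ≠ 0 := by
          rintro h0
          rw [h0, mul_zero] at h
          exact hv1 h.symm
        exact ⟨by rw [← div_eq_mul_inv, eq_div_iff h0, h], h0⟩
      · rintro ⟨h, h0⟩
        rwa [← div_eq_mul_inv, eq_div_iff h0] at h
  simp only [key]
  rcases eq_or_ne (1 - v + x * v) 0 with h0 | h0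
  · simp [h0, MulChar.map_zero]
  · simp [h0, MulChar.inv_apply']

/-- Greene's integral representation of `₂F₁` over a finite field. -/
theorem gauss2F1_eq_sum (A B C : MulChar F ℂ) {x : F} (hx : x ≠ 0) :
    gauss2F1 A B C x = (B * C) (-1) / (Fintype.card F : ℂ) *
      ∑ y : F, B y * (B⁻¹ * C) (1 - y) * A⁻¹ (1 - x * y) := by
  classical
  let _ : Fintype (MulChar F ℂ) := Fintype.ofFinite _
  have hq : (Fintype.card F : ℂ) ≠ 0 := Nat.cast_ne_zero.mpr Fintype.card_ne_zero
  have hq1 : (Fintype.card F : ℂ) - 1 ≠ 0 := by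
    rw [sub_ne_zero]
    exact_mod_cast Fintype.one_lt_card.ne'
  have expand : ∑ ψ : MulChar F ℂ, jacobiSum (A * ψ) ψ⁻¹ * jacobiSum (B * ψ) (C⁻¹ * ψ⁻¹) * ψ x =
      ∑ v : F, B v * C⁻¹ (1 - v) * ∑ u : F, A u *
        (if u * (1 - u)⁻¹ * (v * (1 - v)⁻¹) * x = 1 then (Fintype.card F : ℂ) - 1 else 0) := by
    simp only [jacobiSum, Finset.sum_mul, ← MulChar.sum_apply, Finset.mul_sum]
    rw [Finset.sum_comm, Finset.sum_congr rfl fun _ _ ↦ Finset.sum_comm]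
    refine Finset.sum_congr rfl fun v _ ↦ Finset.sum_congr rfl fun u _ ↦
      Finset.sum_congr rfl fun ψ _ ↦ ?_
    simp only [MulChar.mul_apply, MulChar.inv_apply' ψ, map_mul]
    ring
  have inner_sum (v : F) : B v * C⁻¹ (1 - v) * ∑ u : F, A u *
        (if u * (1 - u)⁻¹ * (v * (1 - v)⁻¹) * x = 1 then (Fintype.card F : ℂ) - 1 else 0) =
      B v * C⁻¹ (1 - v) * (A (1 - v) * A⁻¹ (1 - v + x * v) * ((Fintype.card F : ℂ) - 1)) := by
    rcases eq_or_ne v 0 with hv | hv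
    · simp [hv, MulChar.map_zero]
    rcases eq_or_ne (1 - v) 0 with hv1 | hv1
    · simp [hv1, MulChar.map_zero]
    rw [sum_mulChar_ite_eq A hv hv1 hx]
  have change_var : ∑ v : F, B v * C⁻¹ (1 - v) * (A (1 - v) * A⁻¹ (1 - v + x * v)) =
      B (-1) * ∑ y : F, B y * (B⁻¹ * C) (1 - y) * A⁻¹ (1 - x * y) := by
    rw [Finset.mul_sum,
      ← Finset.sum_subset (Finset.subset_univ ({1}ᶜ : Finset F)) (by
        intro v _ hv
        obtain rfl : v = 1 := by simpa using hv
        simp [MulChar.map_zero]),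
      ← Finset.sum_subset (Finset.subset_univ ({1}ᶜ : Finset F)) (by
        intro v _ hv
        obtain rfl : v = 1 := by simpa using hv
        simp [MulChar.map_zero])]
    have mem (y : F) (hy : y ∈ ({1}ᶜ : Finset F)) : y * (y - 1)⁻¹ ∈ ({1}ᶜ : Finset F) := by
      have hy1 : y - 1 ≠ 0 := by simpa [sub_eq_zero] using hy
      simp [← div_eq_mul_inv, div_eq_one_iff_eq hy1, eq_sub_iff_add_eq]
    have invol (y : F) (hy : y ∈ ({1}ᶜ : Finset F)) :
        y * (y - 1)⁻¹ * (y * (y - 1)⁻¹ - 1)⁻¹ = y := by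
      have hy1 : y - 1 ≠ 0 := by simpa [sub_eq_zero] using hy
      have h : y * (y - 1)⁻¹ - 1 = (y - 1)⁻¹ := by field_simp; ring
      rw [h, inv_inv, mul_assoc, inv_mul_cancel₀ hy1, mul_one]
    symm
    refine Finset.sum_nbij' (fun y ↦ y * (y - 1)⁻¹) (fun y ↦ y * (y - 1)⁻¹) mem mem invol invol ?_
    intro y hy
    have hy1 : 1 - y ≠ 0 := by
      rw [sub_ne_zero]
      exact fun h ↦ by simp [← h] at hy
    have hy2 : y - 1 ≠ 0 := by rwa [← neg_ne_zero, neg_sub]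
    have e0 : y * (y - 1)⁻¹ = -1 * y * (1 - y)⁻¹ := by field_simp; ring
    have e1 : 1 - y * (y - 1)⁻¹ = (1 - y)⁻¹ := by field_simp; ring
    have e2 : 1 - y * (y - 1)⁻¹ + x * (y * (y - 1)⁻¹) = (1 - x * y) * (1 - y)⁻¹ := by
      field_simp; ring
    have hA : A (1 - y)⁻¹ * A (1 - y) = 1 := by
      rw [← map_mul, inv_mul_cancel₀ hy1, map_one]
    simp only [e2]
    simp only [e1, MulChar.mul_apply]
    rw [e0]
    simp only [MulChar.inv_apply', inv_inv, map_mul]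
    linear_combination (-(B (-1) * B y * B (1 - y)⁻¹ * C (1 - y) * A (1 - x * y)⁻¹)) * hA
  have total := expand.trans (Finset.sum_congr rfl fun v _ ↦ inner_sum v)
  simp only [← mul_assoc _ _ ((Fintype.card F : ℂ) - 1)] at total
  rw [← Finset.sum_mul, change_var] at total
  rw [gauss2F1, total, MulChar.mul_apply]
  generalize ∑ y : F, B y * (B⁻¹ * C) (1 - y) * A⁻¹ (1 - x * y) = S
  field_simp

/-- Two nontrivial characters of a finite field whose squares are trivial agree. -/
theorem MulChar.eq_of_sq_eq_one {χ ψ : MulChar F ℂ} (hχ : χ ^ 2 = 1) (hψ : ψ ^ 2 = 1)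
    (hχ1 : χ ≠ 1) (hψ1 : ψ ≠ 1) : χ = ψ := by
  obtain ⟨g, hg⟩ := IsCyclic.exists_generator (α := Fˣ)
  have key {ξ : MulChar F ℂ} (hξ : ξ ^ 2 = 1) (hξ1 : ξ ≠ 1) : ξ g = -1 := by
    have h2 : ξ g ^ 2 = 1 := by
      rw [← MulChar.pow_apply_coe, hξ, MulChar.one_apply_coe]
    refine (by simpa using h2 : ξ g = 1 ∨ ξ g = -1).resolve_left fun h ↦ ?_
    exact hξ1 ((MulChar.eq_iff hg ξ 1).mpr (by rw [h, MulChar.one_apply_coe]))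
  exact (MulChar.eq_iff hg χ ψ).mpr (by rw [key hχ hχ1, key hψ hψ1])

/-- The powers of a character `η` of order `m` count the solutions of `x ^ m = z`. -/
theorem MulChar.sum_pow_apply_eq_card [DecidableEq F] (η : MulChar F ℂ) {z : F} (hz : z ≠ 0) :
    ∑ k ∈ Finset.range (orderOf η), (η ^ k) z =
      (Finset.univ.filter fun x : F ↦ x ^ orderOf η = z).card := by
  set m := orderOf η
  have hm0 : m ≠ 0 := (orderOf_pos η).ne'
  have hdvd : m ∣ Fintype.card Fˣ := by
    rw [Fintype.card_units]
    exact η.orderOf_dvd_card_sub_one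
  obtain ⟨u, rfl⟩ : IsUnit z := hz.isUnit
  have hηm : η u ^ m = 1 := by
    rw [← MulChar.pow_apply_coe, pow_orderOf_eq_one, MulChar.one_apply_coe]
  simp only [MulChar.pow_apply_coe]
  by_cases hu : ∃ w : Fˣ, w ^ m = u
  · have hu1 : η u = 1 := by
      obtain ⟨w, rfl⟩ := hu
      rw [Units.val_pow_eq_pow_val, map_pow, ← MulChar.pow_apply_coe, pow_orderOf_eq_one,
        MulChar.one_apply_coe]
    have h1 : (Finset.univ.filter fun x : F ↦ x ^ m = u).card =
        (Finset.univ.filter fun w : Fˣ ↦ powMonoidHom m w = u).card := by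
      symm
      refine Finset.card_bij (fun w _ ↦ (w : F)) ?_ (fun _ _ _ _ h ↦ Units.ext h) ?_
      · intro w hw
        simpa [Units.ext_iff] using hw
      · intro x hx
        rw [Finset.mem_filter_univ] at hx
        have hx0 : x ≠ 0 := by
          rintro rfl
          rw [zero_pow hm0] at hx
          exact u.ne_zero hx.symm
        exact ⟨Units.mk0 x hx0, by simp [Units.ext_iff, hx], rfl⟩
    have h2 : (Finset.univ.filter fun w : Fˣ ↦ powMonoidHom m w = 1).card = m := by
      have := IsCyclic.card_powMonoidHom_ker (G := Fˣ) m
      rw [Nat.card_eq_fintype_card (α := Fˣ), Nat.gcd_eq_right hdvd] at this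
      rw [← Fintype.card_subtype, ← Nat.card_eq_fintype_card]
      exact this
    rw [h1, MonoidHom.card_fiber_eq_of_mem_range (powMonoidHom m : Fˣ →* Fˣ) (y := 1) hu
      ⟨1, map_one _⟩, h2]
    simp [hu1]
  · have hu1 : η u ≠ 1 := by
      intro h
      obtain ⟨g, hg⟩ := IsCyclic.exists_generator (α := Fˣ)
      obtain ⟨j, rfl⟩ := (isOfFinOrder_of_finite g).mem_powers_iff_mem_zpowers.mpr (hg u)
      have hj : η ^ j = 1 := by
        rw [MulChar.eq_iff hg, MulChar.pow_apply_coe, MulChar.one_apply_coe, ← map_pow,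
          ← Units.val_pow_eq_pow_val]
        exact h
      obtain ⟨i, rfl⟩ := orderOf_dvd_of_pow_eq_one hj
      exact hu ⟨g ^ i, by rw [← pow_mul, mul_comm]⟩
    rw [geom_sum_eq hu1, hηm, sub_self, zero_div, eq_comm, Nat.cast_eq_zero,
      Finset.card_eq_zero, Finset.filter_eq_empty_iff]
    intro x _ hx
    have hx0 : x ≠ 0 := by
      rintro rfl
      rw [zero_pow hm0] at hx
      exact u.ne_zero hx.symm
    exact hu ⟨Units.mk0 x hx0, by simp [Units.ext_iff, hx]⟩

theorem MulChar.sum_sum_pow_mul [DecidableEq F] (η : MulChar F ℂ) (f : F → ℂ) :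
    ∑ k ∈ Finset.range (orderOf η), ∑ z : F, (η ^ k) z * f z =
      ∑ x ∈ ({0}ᶜ : Finset F), f (x ^ orderOf η) := by
  have hm0 : orderOf η ≠ 0 := (orderOf_pos η).ne'
  rw [Finset.sum_comm, ← Finset.sum_subset (Finset.subset_univ ({0}ᶜ : Finset F))
    (by
      intro v _ hv
      obtain rfl : v = 0 := by simpa using hv
      simp),
    ← Finset.sum_fiberwise_of_maps_to (s := ({0}ᶜ : Finset F)) (t := ({0}ᶜ : Finset F))
      (f := fun x ↦ f (x ^ orderOf η)) (g := fun x ↦ x ^ orderOf η) (by intro x hx; simp_all)]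
  refine Finset.sum_congr rfl fun z hz ↦ ?_
  have hz0 : z ≠ 0 := by simpa using hz
  rw [← Finset.sum_mul, MulChar.sum_pow_apply_eq_card η hz0,
    Finset.sum_congr rfl (g := fun _ ↦ f z) (by intro x hx; rw [(Finset.mem_filter.mp hx).2]),
    Finset.sum_const, nsmul_eq_mul]
  congr 3
  ext x
  simp only [Finset.mem_filter, Finset.mem_univ, true_and, Finset.mem_compl,
    Finset.mem_singleton, iff_and_self]
  rintro h rfl
  exact hz0 (by rw [← h, zero_pow hm0])

end MulCharSums

/-- Let `F = F_q` with `q` odd, `φ` its quadratic character, `m ≥ 1` with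
`q ≡ 1 (mod 2m)`, `a, b ∈ F_q^×` with `a ≠ b`, and `χ` a multiplicative character of order
`2m`. Then
`ψ_{(m,m)}(a,b) = φ(ab) + q·φ(−ab)·∑_{k=0}^{m−1} χ^{2k}(−a)·₂F₁(φ, χ^{2k}; χ^{2k+m} | a/b)`,
where `ψ_{(m,m)}(a,b) = ∑_x φ(xᵐ + a)·φ(xᵐ + b)`. -/
theorem psi_mm_eq_hypergeometric
    {F : Type*} [Field F] [Fintype F] [DecidableEq F]
    (hq : Odd (Fintype.card F)) (m : ℕ) (hm : 0 < m)
    (hqm : Fintype.card F % (2 * m) = 1)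
    (a b : F) (ha : a ≠ 0) (hb : b ≠ 0) (hab : a ≠ b)
    (χ : MulChar F ℂ) (hχ : orderOf χ = 2 * m) :
    (∑ x : F, (quadCharℂ F) (x ^ m + a) * (quadCharℂ F) (x ^ m + b)) =
      (quadCharℂ F) (a * b) +
        (Fintype.card F : ℂ) * (quadCharℂ F) (-(a * b)) *
          ∑ k ∈ Finset.range m, (χ ^ (2 * k)) (-a) *
            gauss2F1 (quadCharℂ F) (χ ^ (2 * k)) (χ ^ (2 * k + m)) (a / b) := by
  set φ := quadCharℂ F with hφ
  set q := (Fintype.card F : ℂ)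
  have hq0 : q ≠ 0 := Nat.cast_ne_zero.mpr Fintype.card_ne_zero
  have hchar : ringChar F ≠ 2 := by
    intro h
    exact Nat.not_even_iff_odd.mpr hq (FiniteField.even_card_iff_char_two.mp h |> Nat.even_iff.mpr)
  have hφsq : φ ^ 2 = 1 := by
    refine MulChar.ext fun u ↦ ?_
    rw [MulChar.pow_apply_coe, MulChar.one_apply_coe, hφ, quadCharℂ, MulChar.ringHomComp_apply,
      ← map_pow, quadraticChar_sq_one u.ne_zero, map_one]
  have hφ1 : φ ≠ 1 :=
    (MulChar.ringHomComp_ne_one_iff (Int.cast_injective (α := ℂ))).mpr (quadraticChar_ne_one hchar)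
  have hφinv : φ⁻¹ = φ := inv_eq_of_mul_eq_one_right (by rw [← sq, hφsq])
  have hφφ {x : F} (hx : x ≠ 0) : φ x * φ x = 1 := by
    rw [← MulChar.mul_apply, ← sq, hφsq, MulChar.one_apply hx.isUnit]
  have hχm : χ ^ m = φ := by
    refine MulChar.eq_of_sq_eq_one ?_ hφsq ?_ hφ1
    · rw [← pow_mul, mul_comm, ← hχ, pow_orderOf_eq_one]
    · exact pow_ne_one_of_lt_orderOf hm.ne' (by omega)
  have hη : orderOf (χ ^ 2) = m := by
    rw [orderOf_pow_of_dvd two_ne_zero (hχ ▸ dvd_mul_right 2 m), hχ,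
      Nat.mul_div_cancel_left _ two_pos]
  have hab0 : a / b ≠ 0 := div_ne_zero ha hb
  have hF (k : ℕ) : (χ ^ (2 * k)) (-a) *
      gauss2F1 φ (χ ^ (2 * k)) (χ ^ (2 * k + m)) (a / b) =
      φ (-1) / q * ∑ z : F, ((χ ^ 2) ^ k) z * (φ (1 + z / a) * φ (1 + z / b)) := by
    have hinv : (χ ^ (2 * k))⁻¹ * χ ^ (2 * k + m) = φ := by
      rw [pow_add, inv_mul_cancel_left, hχm]
    have hneg : (χ ^ (2 * k) * χ ^ (2 * k + m)) (-1) = φ (-1) := by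
      rw [pow_add, ← mul_assoc, hχm, MulChar.mul_apply, MulChar.mul_apply, ← map_mul]
      simp
    rw [gauss2F1_eq_sum _ _ _ hab0, hinv, hneg, hφinv, mul_left_comm, Finset.mul_sum]
    congr 1
    refine Fintype.sum_equiv (Equiv.mulLeft₀ (-a) (neg_ne_zero.mpr ha)) _ _ fun y ↦ ?_
    have e1 : 1 + -a * y / a = 1 - y := by field_simp; ring
    have e2 : 1 + -a * y / b = 1 - a / b * y := by field_simp; ring
    simp only [Equiv.mulLeft₀_apply, e1, e2, map_mul, pow_mul]
    ring
  rw [Finset.sum_congr rfl fun k _ ↦ hF k, ← Finset.mul_sum]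
  have hsum := MulChar.sum_sum_pow_mul (χ ^ 2) fun z ↦ φ (1 + z / a) * φ (1 + z / b)
  rw [hη] at hsum
  have hterm (x : F) : φ (x ^ m + a) * φ (x ^ m + b) =
      φ (a * b) * (φ (1 + x ^ m / a) * φ (1 + x ^ m / b)) := by
    rw [← map_mul, ← map_mul, ← map_mul]
    congr 1
    field_simp
    ring
  have hconst : q * φ (-(a * b)) * (φ (-1) / q) = φ (a * b) := by
    rw [← neg_one_mul, map_mul]
    field_simp
    linear_combination φ (a * b) * hφφ (neg_ne_zero.mpr (one_ne_zero (α := F)))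
  rw [hsum, ← mul_assoc, hconst, ← Finset.sum_add_sum_compl {(0 : F)}, Finset.sum_singleton,
    zero_pow hm.ne', zero_add, zero_add, map_mul, Finset.mul_sum, ← map_mul,
    Finset.sum_congr rfl fun x _ ↦ hterm x]
end

section
/- Let a, b ∈ F_q^× and set λ = a²/b. Assume λ ≠ −1. Then (1 + Σ_{x∈F_q} φ(x·(x+a)·(x²+b)))² = q + q²·φ(λ+1)·₃F₂(φ,φ,φ; ε,ε | λ/(λ+1)). -/
/-- Greene's Gaussian hypergeometric series `₃F₂(φ,φ,φ; ε,ε | x)` over the finite field `F`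
(all upper parameters the quadratic character `φ`, lower parameters trivial):
`₃F₂(φ,φ,φ; ε,ε | x) = (1/(q²(q−1))) · ∑_ψ ψ(−1)·J(φψ, ψ⁻¹)³·ψ(x)`,
the sum running over all multiplicative characters `ψ` of `F`,
where `J(A,B) = ∑_x A(x)·B(1−x)` is the Jacobi sum. -/
noncomputable def gauss3F2phi {F : Type*} [Field F] [Fintype F] [DecidableEq F] (x : F) : ℂ :=
  haveI : Fintype (MulChar F ℂ) := Fintype.ofFinite _
  1 / ((Fintype.card F : ℂ) ^ 2 * ((Fintype.card F : ℂ) - 1)) *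
    ∑ ψ : MulChar F ℂ, ψ (-1) * jacobiSum (quadCharℂ F * ψ) ψ⁻¹ ^ 3 * ψ x

section QuadraticCharSums

variable {F : Type*} [Field F] [Fintype F] [DecidableEq F]

theorem quadraticChar_eq_of_mul_sq_eq {x y d e : F} (hd : d ≠ 0) (he : e ≠ 0)
    (h : x * d ^ 2 = y * e ^ 2) : quadraticChar F x = quadraticChar F y := by
  have := congrArg (quadraticChar F) h
  rwa [map_mul, map_mul, quadraticChar_sq_one' hd, quadraticChar_sq_one' he, mul_one,
    mul_one] at this

theorem four_ne_zero_of_ringChar_ne_two {F : Type*} [Field F] (hF : ringChar F ≠ 2) :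
    (4 : F) ≠ 0 := by
  rw [show (4 : F) = 2 * 2 by norm_num]
  exact mul_ne_zero (Ring.two_ne_zero hF) (Ring.two_ne_zero hF)

theorem sum_comp_affine {F : Type*} [Field F] [Fintype F] (f : F → ℤ) {α : F} (hα : α ≠ 0) (β : F) :
    ∑ x, f (α * x + β) = ∑ x, f x :=
  ((Equiv.mulLeft₀ α hα).trans (Equiv.addRight β)).sum_comp f

theorem sum_comp_mul_inv {F : Type*} [Field F] [Fintype F] (f : F → ℤ) {α : F} (hα : α ≠ 0) :
    ∑ x, f (α * x⁻¹) = ∑ x, f x :=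
  (inv_involutive.toPerm.trans (Equiv.mulLeft₀ α hα)).sum_comp f

theorem sum_comp_eq_sum_mul_count {F : Type*} [Fintype F] [DecidableEq F] (g : F → F) (h : F → ℤ) :
    ∑ x, h (g x) = ∑ y, h y * ∑ x, if g x = y then 1 else 0 := by
  simp_rw [Finset.mul_sum]
  rw [Finset.sum_comm]
  simp

theorem sum_eq_zero_add_sum_mul (g : F → F → ℤ) :
    ∑ s, ∑ P, g s P = ∑ P, g 0 P + (∑ m, ∑ s, g s (s * m) - ∑ _m : F, g 0 0) := by
  rw [Finset.sum_comm (f := fun m s => g s (s * m)), ← Finset.sum_erase_add _ _ (Finset.mem_univ 0),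
    ← Finset.sum_erase_add (a := (0 : F)) _ (fun s => ∑ m, g s (s * m)) (Finset.mem_univ 0)]
  have : ∑ s ∈ Finset.univ.erase (0 : F), ∑ P, g s P
      = ∑ s ∈ Finset.univ.erase (0 : F), ∑ m, g s (s * m) := by
    refine Finset.sum_congr rfl fun s hs => ?_
    exact (Equiv.sum_comp (Equiv.mulLeft₀ s (Finset.ne_of_mem_erase hs)) (g s)).symm
  simp only [this, zero_mul]
  ring

variable (hF : ringChar F ≠ 2)
include hF

theorem sum_quadraticChar_affine {α : F} (hα : α ≠ 0) (β : F) :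
    ∑ x, quadraticChar F (α * x + β) = 0 := by
  rw [sum_comp_affine _ hα, quadraticChar_sum_zero hF]

theorem count_sq_eq (d : F) :
    (∑ x : F, if x ^ 2 = d then 1 else 0 : ℤ) = 1 + quadraticChar F d := by
  rw [add_comm, ← quadraticChar_card_sqrts hF d, Finset.sum_boole]
  congr 2
  ext
  simp

theorem count_quadratic_roots {α : F} (hα : α ≠ 0) (β γ : F) :
    (∑ x : F, if α * x ^ 2 + β * x + γ = 0 then 1 else 0 : ℤ)
      = 1 + quadraticChar F (β ^ 2 - 4 * α * γ) := by
  have h2 : (2 : F) ≠ 0 := Ring.two_ne_zero hF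
  rw [← count_sq_eq hF, ← sum_comp_affine (fun x => if x ^ 2 = β ^ 2 - 4 * α * γ then 1 else 0)
    (mul_ne_zero h2 hα) β]
  refine Finset.sum_congr rfl fun x _ => if_congr ?_ rfl rfl
  have h4 : 4 * α ≠ 0 := mul_ne_zero (four_ne_zero_of_ringChar_ne_two hF) hα
  rw [← mul_right_inj' h4, ← sub_eq_zero, ← sub_eq_zero (b := β ^ 2 - _)]
  ring_nf

theorem sum_quadraticChar_mul_sub {d : F} (hd : d ≠ 0) :
    ∑ x, quadraticChar F (x * (x - d)) = -1 := by
  have h : ∀ x, quadraticChar F (x * (x - d))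
      = quadraticChar F (-d * x⁻¹ + 1) - if x = 0 then 1 else 0 := by
    intro x
    split_ifs with hx
    · simp [hx]
    · rw [sub_zero]
      exact quadraticChar_eq_of_mul_sq_eq (d := 1) (e := x) one_ne_zero hx (by field_simp; ring)
  simp_rw [h, Finset.sum_sub_distrib]
  rw [sum_comp_mul_inv (fun x => quadraticChar F (x + 1)) (neg_ne_zero.2 hd)]
  have := sum_quadraticChar_affine hF one_ne_zero 1
  simp_rw [one_mul] at this
  rw [this]
  simp

theorem sum_quadraticChar_quadratic {α β γ : F} (hα : α ≠ 0) (hD : β ^ 2 - 4 * α * γ ≠ 0) :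
    ∑ x, quadraticChar F (α * x ^ 2 + β * x + γ) = -quadraticChar F α := by
  have h2 : (2 : F) ≠ 0 := Ring.two_ne_zero hF
  set D := β ^ 2 - 4 * α * γ with hDdef
  have hsq : ∑ x, quadraticChar F (x ^ 2 - D) = -1 := by
    rw [sum_comp_eq_sum_mul_count (fun x => x ^ 2) (fun y => quadraticChar F (y - D))]
    simp_rw [count_sq_eq hF, mul_add, mul_one, Finset.sum_add_distrib, ← map_mul, mul_comm (_ - D)]
    rw [sum_quadraticChar_mul_sub hF hD]
    have := sum_quadraticChar_affine hF one_ne_zero (-D)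
    simp only [one_mul, ← sub_eq_add_neg] at this
    rw [this, zero_add]
  rw [← mul_neg_one, ← hsq, ← sum_comp_affine (fun x => quadraticChar F (x ^ 2 - D)) (mul_ne_zero h2 hα) β,
    Finset.mul_sum]
  refine Finset.sum_congr rfl fun x _ => ?_
  rw [← map_mul]
  exact quadraticChar_eq_of_mul_sq_eq (d := 2 * α) (e := 1) (mul_ne_zero h2 hα) one_ne_zero
    (by rw [hDdef]; ring)

theorem sum_sum_comp_add_mul (f : F → F → ℤ) :
    ∑ x, ∑ y, f (x + y) (x * y)
      = ∑ s, ∑ p, f s p * (1 + quadraticChar F (s ^ 2 - 4 * p)) := by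
  have h : ∀ x, ∑ y, f (x + y) (x * y) = ∑ s, f s (x * (s - x)) := by
    intro x
    rw [← Equiv.sum_comp (Equiv.addLeft x) (fun s => f s (x * (s - x)))]
    simp
  simp_rw [h]
  rw [Finset.sum_comm]
  refine Finset.sum_congr rfl fun s _ => ?_
  rw [sum_comp_eq_sum_mul_count (fun x => x * (s - x)) (f s)]
  refine Finset.sum_congr rfl fun p _ => ?_
  have := count_quadratic_roots hF (one_ne_zero (α := F)) (-s) p
  rw [show s ^ 2 - 4 * p = (-s) ^ 2 - 4 * 1 * p by ring, ← this]
  congr 1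
  refine Finset.sum_congr rfl fun x _ => if_congr ?_ rfl rfl
  rw [← sub_eq_zero, ← neg_eq_zero]
  ring_nf

/-- The `2`-isogeny between `y² = x(x² + Ax + B)` and `y² = (z + A)(z² - 4B)` preserves the
character sum. -/
theorem sum_quadraticChar_isogeny (A B : F) :
    ∑ x, quadraticChar F (x * (x ^ 2 + A * x + B))
      = ∑ z, quadraticChar F ((z + A) * (z ^ 2 - 4 * B)) := by
  have hlin : ∑ z, quadraticChar F (z + A) = 0 := by
    simpa using sum_quadraticChar_affine hF one_ne_zero A
  have hroots : ∀ z : F, quadraticChar F (z + A) + quadraticChar F ((z + A) * (z ^ 2 - 4 * B))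
      = ∑ x : F, if x ^ 2 - z * x + B = 0 then quadraticChar F (z + A) else 0 := by
    intro z
    have := count_quadratic_roots hF (one_ne_zero (α := F)) (-z) B
    simp only [one_mul, mul_one, neg_mul, ← sub_eq_add_neg, neg_sq] at this
    simp_rw [map_mul (quadraticChar F) (z + A), ← mul_one_add, ← this, Finset.mul_sum, mul_ite,
      mul_one, mul_zero]
  rw [← zero_add (∑ z, quadraticChar F ((z + A) * _)), ← hlin, ← Finset.sum_add_distrib,
    Finset.sum_congr rfl fun z _ => hroots z, Finset.sum_comm]
  refine Finset.sum_congr rfl fun x _ => ?_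
  by_cases hx : x = 0
  · by_cases hB : B = 0 <;> simp [hx, hB, hlin, -quadraticChar_apply, MulChar.map_zero]
  · have : ∀ z : F, x ^ 2 - z * x + B = 0 ↔ z = x + B / x := by
      intro z
      rw [show x ^ 2 - z * x + B = -x * (z - (x + B / x)) by field_simp; ring, mul_eq_zero,
        or_iff_right (neg_ne_zero.2 hx), sub_eq_zero]
    simp_rw [this, Finset.sum_ite_eq', Finset.mem_univ, if_true]
    exact quadraticChar_eq_of_mul_sq_eq one_ne_zero hx (by field_simp; ring)

variable {c : F} (hc : c ≠ 0) (hk : 1 + c ≠ 0)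
include hc hk

theorem sum_sum_quadraticChar_cone :
    ∑ s, ∑ P, quadraticChar F (c * ((1 + c - P + c * s) * (P ^ 2 + c * s ^ 2)))
      = Fintype.card F := by
  have h2 : (2 : F) ≠ 0 := Ring.two_ne_zero hF
  have h4 : (4 : F) ≠ 0 := four_ne_zero_of_ringChar_ne_two hF
  rw [sum_eq_zero_add_sum_mul]
  have hzero : ∀ P, quadraticChar F (c * ((1 + c - P + c * 0) * (P ^ 2 + c * 0 ^ 2)))
      = quadraticChar F (-c * P + c * (1 + c))
        - if P = 0 then quadraticChar F (c * (1 + c)) else 0 := by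
    intro P
    split_ifs with hP
    · simp [hP]
    · rw [sub_zero]
      exact quadraticChar_eq_of_mul_sq_eq one_ne_zero hP (by ring)
  have hline : ∀ m s, quadraticChar F
        (c * ((1 + c - s * m + c * s) * ((s * m) ^ 2 + c * s ^ 2)))
      = quadraticChar F (c * (m ^ 2 + c)) * quadraticChar F ((c - m) * s + (1 + c))
        - if s = 0 then quadraticChar F (c * (m ^ 2 + c) * (1 + c)) else 0 := by
    intro m s
    rw [← map_mul]
    split_ifs with hs
    · simp [hs, -quadraticChar_apply, -map_mul, MulChar.map_zero]
    · rw [sub_zero]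
      exact quadraticChar_eq_of_mul_sq_eq one_ne_zero hs (by ring)
  have hinner : ∀ m, quadraticChar F (c * (m ^ 2 + c)) *
        ∑ s, quadraticChar F ((c - m) * s + (1 + c))
      = if m = c then (Fintype.card F : ℤ) else 0 := by
    intro m
    split_ifs with hm
    · simp only [hm, sub_self, zero_mul, zero_add, Finset.sum_const, Finset.card_univ, nsmul_eq_mul]
      rw [mul_left_comm, ← map_mul, quadraticChar_eq_of_mul_sq_eq (y := 1) (d := 1)
        (e := c * (1 + c)) one_ne_zero (mul_ne_zero hc hk) (by ring), map_one, mul_one]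
    · rw [sum_quadraticChar_affine hF (sub_ne_zero.2 (Ne.symm hm)), mul_zero]
  have hquad : ∑ m, quadraticChar F (c * (m ^ 2 + c) * (1 + c))
      = -quadraticChar F (c * (1 + c)) := by
    rw [← sum_quadraticChar_quadratic hF (β := 0) (γ := c * (1 + c) * c) (mul_ne_zero hc hk)]
    · exact Finset.sum_congr rfl fun m _ => congrArg _ (by ring)
    · rw [show (0 : F) ^ 2 - 4 * (c * (1 + c)) * (c * (1 + c) * c) = -(4 * c * (c * (1 + c)) ^ 2) by
        ring]
      exact neg_ne_zero.2 (mul_ne_zero (mul_ne_zero h4 hc) (pow_ne_zero _ (mul_ne_zero hc hk)))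
  simp_rw [hzero, hline, Finset.sum_sub_distrib, ← Finset.mul_sum, hinner,
    sum_quadraticChar_affine hF (neg_ne_zero.2 hc)]
  simp only [Finset.sum_ite_eq', Finset.mem_univ, if_true, hquad]
  simp

omit hk in
theorem sum_quadraticChar_fibre {m : F} (hm : m ≠ c) :
    ∑ s, quadraticChar F (((c - m) * s + (1 + c)) * (c * s ^ 2 + 4 * m * s - 4))
      = quadraticChar F (-1) *
        ∑ y, quadraticChar F (y * (y - 1) * (y - (m ^ 2 + c) / (m - c) ^ 2)) := by
  have h2 : (2 : F) ≠ 0 := Ring.two_ne_zero hF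
  have h4 : (4 : F) ≠ 0 := four_ne_zero_of_ringChar_ne_two hF
  have he : c - m ≠ 0 := sub_ne_zero.2 (Ne.symm hm)
  have he' : m - c ≠ 0 := sub_ne_zero.2 hm
  set A := (4 * m * (c - m) - 2 * c * (1 + c)) / c with hA
  set n := 1 - c + 2 * m with hn
  have hcubic : ∑ s, quadraticChar F (((c - m) * s + (1 + c)) * (c * s ^ 2 + 4 * m * s - 4))
      = quadraticChar F c * ∑ x, quadraticChar F (x * (x ^ 2 + A * x + n ^ 2)) := by
    rw [← sum_comp_affine (fun x => quadraticChar F (x * (x ^ 2 + A * x + n ^ 2))) he (1 + c),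
      Finset.mul_sum]
    refine Finset.sum_congr rfl fun s _ => ?_
    rw [← map_mul]
    refine quadraticChar_eq_of_mul_sq_eq (d := c - m) (e := 1) he one_ne_zero ?_
    rw [hA, hn]
    field_simp
    ring
  have hα : -(4 * (m - c) ^ 2 / c) ≠ 0 :=
    neg_ne_zero.2 (div_ne_zero (mul_ne_zero h4 (pow_ne_zero _ he')) hc)
  rw [hcubic, sum_quadraticChar_isogeny hF,
    ← sum_comp_affine (fun z => quadraticChar F ((z + A) * (z ^ 2 - 4 * n ^ 2))) hα (-A),
    Finset.mul_sum, Finset.mul_sum]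
  refine Finset.sum_congr rfl fun y _ => ?_
  rw [← map_mul, ← map_mul]
  refine quadraticChar_eq_of_mul_sq_eq (d := c) (e := 8 * (m - c) ^ 3) hc
    (mul_ne_zero ?_ (pow_ne_zero _ he')) ?_
  · rw [show (8 : F) = 2 * 4 by norm_num]; positivity
  · rw [hA, hn]
    field_simp
    ring

theorem sum_sum_quadraticChar_disc :
    ∑ s, ∑ P, quadraticChar F
        ((1 + c - P + c * s) * (P ^ 2 + c * s ^ 2) * (c * s ^ 2 + 4 * P - 4))
      = ∑ m, quadraticChar F (m ^ 2 + c) * ∑ s, quadraticChar F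
        (((c - m) * s + (1 + c)) * (c * s ^ 2 + 4 * m * s - 4)) - quadraticChar F (-1) := by
  have h2 : (2 : F) ≠ 0 := Ring.two_ne_zero hF
  have h4 : (4 : F) ≠ 0 := four_ne_zero_of_ringChar_ne_two hF
  rw [sum_eq_zero_add_sum_mul]
  have hzero : ∀ P, quadraticChar F
        ((1 + c - P + c * 0) * (P ^ 2 + c * 0 ^ 2) * (c * 0 ^ 2 + 4 * P - 4))
      = quadraticChar F (-1 * P ^ 2 + (2 + c) * P + -(1 + c))
        - if P = 0 then quadraticChar F (-(1 + c)) else 0 := by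
    intro P
    split_ifs with hP
    · simp [hP]
    · rw [sub_zero]
      exact quadraticChar_eq_of_mul_sq_eq (e := 2 * P) one_ne_zero (mul_ne_zero h2 hP) (by ring)
  have hline : ∀ m s, quadraticChar F
        ((1 + c - s * m + c * s) * ((s * m) ^ 2 + c * s ^ 2) * (c * s ^ 2 + 4 * (s * m) - 4))
      = quadraticChar F (m ^ 2 + c) * quadraticChar F
        (((c - m) * s + (1 + c)) * (c * s ^ 2 + 4 * m * s - 4))
        - if s = 0 then quadraticChar F (-(1 + c) * (m ^ 2 + c)) else 0 := by
    intro m s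
    rw [← map_mul]
    split_ifs with hs
    · rw [eq_sub_iff_add_eq]
      simp only [hs, ne_eq, OfNat.ofNat_ne_zero, not_false_eq_true, zero_pow, zero_mul, mul_zero,
        zero_add, add_zero, MulChar.map_zero]
      exact quadraticChar_eq_of_mul_sq_eq (d := 2) (e := 1) h2 one_ne_zero (by ring)
    · rw [sub_zero]
      exact quadraticChar_eq_of_mul_sq_eq one_ne_zero hs (by ring)
  have hquad : ∑ m, quadraticChar F (-(1 + c) * (m ^ 2 + c)) = -quadraticChar F (-(1 + c)) := by
    rw [← sum_quadraticChar_quadratic hF (β := 0) (γ := -(1 + c) * c) (neg_ne_zero.2 hk)]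
    · exact Finset.sum_congr rfl fun m _ => congrArg _ (by ring)
    · rw [show (0 : F) ^ 2 - 4 * -(1 + c) * (-(1 + c) * c) = -(4 * c * (1 + c) ^ 2) by ring]
      exact neg_ne_zero.2 (mul_ne_zero (mul_ne_zero h4 hc) (pow_ne_zero _ hk))
  simp_rw [hzero, hline, Finset.sum_sub_distrib, ← Finset.mul_sum]
  rw [sum_quadraticChar_quadratic hF (neg_ne_zero.2 one_ne_zero)
    (by rw [show (2 + c) ^ 2 - 4 * -1 * -(1 + c) = c ^ 2 by ring]; exact pow_ne_zero _ hc)]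
  simp only [Finset.sum_ite_eq', Finset.mem_univ, if_true, hquad]
  simp only [add_zero, mul_zero, ne_eq, OfNat.ofNat_ne_zero, not_false_eq_true, zero_pow]
  ring_nf

theorem count_slope_fibre {y : F} (hy : y ≠ 0) :
    (∑ m, if (m ^ 2 + c) / (m - c) ^ 2 = y then 1 else 0 : ℤ)
      = 1 + quadraticChar F (c * ((1 + c) * y - 1)) - if y = 1 then 1 else 0 := by
  have h2 : (2 : F) ≠ 0 := Ring.two_ne_zero hF
  have hiff : ∀ m, (m ^ 2 + c) / (m - c) ^ 2 = y
      ↔ (y - 1) * m ^ 2 + -(2 * c * y) * m + (y * c ^ 2 - c) = 0 := by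
    intro m
    by_cases hm : m = c
    · rw [hm, sub_self, zero_pow two_ne_zero, div_zero, show (y - 1) * c ^ 2 + -(2 * c * y) * c +
        (y * c ^ 2 - c) = -(c * (1 + c)) by ring]
      exact iff_of_false hy.symm (neg_ne_zero.2 (mul_ne_zero hc hk))
    · rw [div_eq_iff (pow_ne_zero _ (sub_ne_zero.2 hm)), eq_comm, ← sub_eq_zero]
      ring_nf
  simp_rw [hiff]
  split_ifs with h1
  · have : ∀ m : F, (y - 1) * m ^ 2 + -(2 * c * y) * m + (y * c ^ 2 - c) = 0
        ↔ m = (c - 1) / 2 := by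
      intro m
      rw [h1, show (1 - 1) * m ^ 2 + -(2 * c * 1) * m + (1 * c ^ 2 - c)
        = -(2 * c) * (m - (c - 1) / 2) by field_simp; ring, mul_eq_zero,
        or_iff_right (neg_ne_zero.2 (mul_ne_zero h2 hc)), sub_eq_zero]
    simp_rw [this, Finset.sum_ite_eq', Finset.mem_univ, if_true]
    rw [h1, show c * ((1 + c) * 1 - 1) = c ^ 2 by ring, quadraticChar_sq_one' hc]
    norm_num
  · rw [count_quadratic_roots hF (sub_ne_zero.2 h1), sub_zero]
    congr 1
    exact quadraticChar_eq_of_mul_sq_eq (d := 1) (e := 2) one_ne_zero h2 (by ring)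

omit hc hk in
theorem sum_quadraticChar_legendre_mul :
    ∑ μ, quadraticChar F μ * ∑ y, quadraticChar F (y * (y - 1) * (y - μ))
      = quadraticChar F (-1) := by
  simp_rw [Finset.mul_sum]
  rw [Finset.sum_comm]
  have : ∀ y, ∑ μ, quadraticChar F μ * quadraticChar F (y * (y - 1) * (y - μ))
      = -quadraticChar F (-1) * quadraticChar F (y * (y - 1)) := by
    intro y
    by_cases hy : y = 0
    · simp [hy]
    rw [neg_mul_comm, ← neg_one_mul (quadraticChar F _), ← sum_quadraticChar_mul_sub hF hy,
      Finset.sum_mul, Finset.mul_sum]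
    refine Finset.sum_congr rfl fun μ _ => ?_
    simp_rw [← map_mul]
    congr 1
    ring
  simp_rw [this, ← Finset.mul_sum, sum_quadraticChar_mul_sub hF one_ne_zero]
  ring

theorem sum_sum_quadraticChar_disc_eq_legendre :
    ∑ s, ∑ P, quadraticChar F
        ((1 + c - P + c * s) * (P ^ 2 + c * s ^ 2) * (c * s ^ 2 + 4 * P - 4))
      = quadraticChar F (-1) * ∑ μ, quadraticChar F (c * μ * ((1 + c) * μ - 1)) *
        ∑ y, quadraticChar F (y * (y - 1) * (y - μ)) := by
  have h2 : (2 : F) ≠ 0 := Ring.two_ne_zero hF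
  have h4 : (4 : F) ≠ 0 := four_ne_zero_of_ringChar_ne_two hF
  rw [sum_sum_quadraticChar_disc hF hc hk]
  set L : F → ℤ := fun μ => ∑ y, quadraticChar F (y * (y - 1) * (y - μ)) with hL
  have hL1 : L 1 = -1 := by
    have h : ∀ y : F, quadraticChar F (y * (y - 1) * (y - 1))
        = quadraticChar F y - if y = 1 then 1 else 0 := by
      intro y
      split_ifs with hy
      · simp [hy]
      · rw [sub_zero]
        exact quadraticChar_eq_of_mul_sq_eq one_ne_zero (sub_ne_zero.2 hy) (by ring)
    simp_rw [hL, h, Finset.sum_sub_distrib, quadraticChar_sum_zero hF]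
    simp
  have hfib : ∀ m, quadraticChar F (m ^ 2 + c) * ∑ s, quadraticChar F
        (((c - m) * s + (1 + c)) * (c * s ^ 2 + 4 * m * s - 4))
      = quadraticChar F (-1) * (quadraticChar F ((m ^ 2 + c) / (m - c) ^ 2)
          * L ((m ^ 2 + c) / (m - c) ^ 2)) - if m = c then 1 else 0 := by
    intro m
    split_ifs with hm
    · have h : ∀ s, ((c - c) * s + (1 + c)) * (c * s ^ 2 + 4 * c * s - 4)
          = (1 + c) * c * s ^ 2 + (1 + c) * (4 * c) * s + -(4 * (1 + c)) := fun s => by ring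
      have hD : ((1 + c) * (4 * c)) ^ 2 - 4 * ((1 + c) * c) * -(4 * (1 + c)) ≠ 0 := by
        rw [show ((1 + c) * (4 * c)) ^ 2 - 4 * ((1 + c) * c) * -(4 * (1 + c))
          = 4 ^ 2 * (1 + c) ^ 3 * c by ring]
        positivity
      rw [hm]
      simp_rw [h]
      rw [sum_quadraticChar_quadratic hF (mul_ne_zero hk hc) hD, mul_neg, ← map_mul,
        show (c ^ 2 + c) * ((1 + c) * c) = (c * (1 + c)) ^ 2 by ring,
        quadraticChar_sq_one' (mul_ne_zero hc hk)]
      simp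
    · rw [sum_quadraticChar_fibre hF hc hm, sub_zero, mul_left_comm]
      congr 2
      exact quadraticChar_eq_of_mul_sq_eq one_ne_zero (sub_ne_zero.2 hm)
        (by have := sub_ne_zero.2 hm; field_simp)
  have hcount : ∀ y, quadraticChar F y * L y *
        (∑ m, if (m ^ 2 + c) / (m - c) ^ 2 = y then 1 else 0 : ℤ)
      = quadraticChar F y * L y + quadraticChar F (c * y * ((1 + c) * y - 1)) * L y
        - if y = 1 then L y else 0 := by
    intro y
    by_cases hy : y = 0
    · simp [hy]
    rw [count_slope_fibre hF hc hk hy, show c * y * ((1 + c) * y - 1)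
      = y * (c * ((1 + c) * y - 1)) by ring, map_mul _ y]
    split_ifs with h1
    · rw [h1, map_one]; ring
    · ring
  rw [Finset.sum_congr rfl fun m _ => hfib m, Finset.sum_sub_distrib, ← Finset.mul_sum,
    sum_comp_eq_sum_mul_count (fun m => (m ^ 2 + c) / (m - c) ^ 2)
    (fun y => quadraticChar F y * L y)]
  simp_rw [hcount, Finset.sum_sub_distrib, Finset.sum_add_distrib]
  rw [sum_quadraticChar_legendre_mul hF]
  simp only [Finset.sum_ite_eq', Finset.mem_univ, if_true, hL1]
  have : quadraticChar F (-1) * quadraticChar F (-1) = 1 := by rw [← map_mul]; simp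
  linear_combination this

omit hF hk in
theorem sum_sum_quadraticChar_legendre :
    quadraticChar F (-1) * ∑ μ, quadraticChar F (c * μ * ((1 + c) * μ - 1)) *
        ∑ y, quadraticChar F (y * (y - 1) * (y - μ))
      = quadraticChar F c *
        ∑ u, ∑ v, quadraticChar F (u * (u - 1) * v * (v - 1) * (1 + c - u * v)) := by
  simp_rw [Finset.mul_sum]
  rw [Finset.sum_comm]
  refine Eq.trans ?_ (sum_comp_mul_inv _ (one_ne_zero (α := F)))
  refine Finset.sum_congr rfl fun u _ => ?_
  by_cases hu : u = 0
  · simp [hu]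
  refine Eq.trans ?_ (sum_comp_mul_inv _ hu)
  refine Finset.sum_congr rfl fun v _ => ?_
  by_cases hv : v = 0
  · simp [hv]
  simp_rw [← map_mul]
  exact quadraticChar_eq_of_mul_sq_eq (d := 1) (e := u * v ^ 2) one_ne_zero (by positivity)
    (by field_simp; ring)

theorem sq_sum_quadraticChar :
    (∑ x, quadraticChar F ((1 + x) * (1 + c * x ^ 2))) ^ 2
      = Fintype.card F + quadraticChar F c *
        ∑ u, ∑ v, quadraticChar F (u * (u - 1) * v * (v - 1) * (1 + c - u * v)) := by
  rw [← sum_sum_quadraticChar_legendre hc, ← sum_sum_quadraticChar_disc_eq_legendre hF hc hk,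
    ← sum_sum_quadraticChar_cone hF hc hk, ← Finset.sum_add_distrib, sq, Finset.sum_mul_sum]
  have hprod : ∀ x y : F,
      quadraticChar F ((1 + x) * (1 + c * x ^ 2)) * quadraticChar F ((1 + y) * (1 + c * y ^ 2))
        = quadraticChar F ((1 + (x + y) + x * y) *
          ((1 - c * (x * y)) ^ 2 + c * (x + y) ^ 2)) := by
    intro x y
    rw [← map_mul]
    congr 1
    ring
  simp_rw [hprod]
  rw [sum_sum_comp_add_mul hF (fun s p => quadraticChar F ((1 + s + p) *
    ((1 - c * p) ^ 2 + c * s ^ 2)))]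
  refine Finset.sum_congr rfl fun s _ => ?_
  rw [← Finset.sum_add_distrib]
  refine Eq.trans ?_ (sum_comp_affine _ (neg_ne_zero.2 hc) 1)
  refine Finset.sum_congr rfl fun p _ => ?_
  rw [mul_one_add, ← map_mul]
  congr 1 <;> exact quadraticChar_eq_of_mul_sq_eq hc one_ne_zero (by ring)

end QuadraticCharSums

theorem MulChar.sum_mulChar_apply {F : Type*} [Field F] [Fintype F] [DecidableEq F]
    [Fintype (MulChar F ℂ)] (x : F) :
    ∑ ψ : MulChar F ℂ, ψ x = if x = 1 then (Fintype.card F : ℂ) - 1 else 0 := by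
  split_ifs with hx
  · have h := MulChar.card_eq_card_units_of_hasEnoughRootsOfUnity F ℂ
    rw [Nat.card_eq_fintype_card, Nat.card_eq_fintype_card] at h
    simp [hx, h, Fintype.card_eq_card_units_add_one (α := F)]
  · obtain ⟨χ, hχ⟩ := MulChar.exists_apply_ne_one_of_hasEnoughRootsOfUnity F ℂ hx
    refine eq_zero_of_mul_eq_self_left hχ ?_
    simp only [Finset.mul_sum, ← MulChar.mul_apply]
    exact Fintype.sum_bijective _ (Group.mulLeft_bijective χ) _ _ fun _ => rfl

section GaussHypergeometric

variable {F : Type*} [Field F] [Fintype F] [DecidableEq F]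

theorem quadCharℂ_apply (x : F) : quadCharℂ F x = quadraticChar F x := rfl

theorem jacobiSum_quadCharℂ_mul (ψ : MulChar F ℂ) :
    ψ (-1) * jacobiSum (quadCharℂ F * ψ) ψ⁻¹
      = ∑ u, (quadraticChar F (u * (u - 1)) : ℂ) * ψ u := by
  rw [jacobiSum, ← Equiv.sum_comp ((Equiv.subLeft (1 : F)).trans
    (inv_involutive.toPerm.trans (Equiv.subLeft (1 : F)))), Finset.mul_sum]
  refine Finset.sum_congr rfl fun u _ => ?_
  simp only [Equiv.coe_trans, Function.comp_apply, Equiv.subLeft_apply,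
    Function.Involutive.coe_toPerm, MulChar.mul_apply, quadCharℂ_apply, MulChar.inv_apply',
    sub_sub_cancel, inv_inv]
  by_cases hu : u = 1
  · simp [hu, MulChar.map_zero]
  have hu' : 1 - u ≠ 0 := sub_ne_zero.2 (Ne.symm hu)
  rw [quadraticChar_eq_of_mul_sq_eq (x := 1 - (1 - u)⁻¹) (y := u * (u - 1)) hu' one_ne_zero
    (by field_simp; ring), mul_assoc, mul_left_comm, ← map_mul, ← map_mul]
  congr 2
  field_simp
  ring

theorem sum_mulChar_jacobiSum_pow_three [Fintype (MulChar F ℂ)] (t : F) (ht : t ≠ 0) :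
    ∑ ψ : MulChar F ℂ, ψ (-1) * jacobiSum (quadCharℂ F * ψ) ψ⁻¹ ^ 3 * ψ t
      = ((Fintype.card F : ℂ) - 1) *
        (∑ u, ∑ v, quadraticChar F (u * (u - 1) * v * (v - 1) * (1 - t * u * v)) : ℤ) := by
  have hψ : ∀ ψ : MulChar F ℂ, ψ (-1) * jacobiSum (quadCharℂ F * ψ) ψ⁻¹ ^ 3 * ψ t
      = ∑ u, ∑ v, ∑ w, ((quadraticChar F (u * (u - 1)) * quadraticChar F (v * (v - 1)) *
          quadraticChar F (w * (w - 1)) : ℤ) : ℂ) * ψ (t * u * v * w) := by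
    intro ψ
    have hsq : ψ (-1) * ψ (-1) = 1 := by rw [← map_mul]; simp
    have hcube : ψ (-1) * jacobiSum (quadCharℂ F * ψ) ψ⁻¹ ^ 3
        = (ψ (-1) * jacobiSum (quadCharℂ F * ψ) ψ⁻¹) ^ 3 := by
      linear_combination (-ψ (-1) * jacobiSum (quadCharℂ F * ψ) ψ⁻¹ ^ 3) * hsq
    rw [hcube, jacobiSum_quadCharℂ_mul, pow_three', Finset.sum_mul_sum, Finset.sum_mul,
      Finset.sum_mul]
    refine Finset.sum_congr rfl fun u _ => ?_
    rw [Finset.sum_mul, Finset.sum_mul]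
    refine Finset.sum_congr rfl fun v _ => ?_
    rw [Finset.mul_sum, Finset.sum_mul]
    refine Finset.sum_congr rfl fun w _ => ?_
    rw [map_mul ψ, map_mul ψ, map_mul ψ]
    push_cast
    ring
  simp_rw [hψ]
  rw [Finset.sum_comm]
  push_cast
  rw [Finset.mul_sum]
  refine Finset.sum_congr rfl fun u _ => ?_
  rw [Finset.sum_comm, Finset.mul_sum]
  refine Finset.sum_congr rfl fun v _ => ?_
  rw [Finset.sum_comm]
  simp_rw [← Finset.mul_sum, MulChar.sum_mulChar_apply]
  by_cases hu : u = 0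
  · simp [hu]
  by_cases hv : v = 0
  · simp [hv]
  have hw : ∀ w, t * u * v * w = 1 ↔ w = (t * u * v)⁻¹ := fun w => by
    rw [mul_comm, mul_eq_one_iff_eq_inv₀ (by positivity)]
  simp_rw [hw, mul_ite, mul_zero, Finset.sum_ite_eq', Finset.mem_univ, if_true]
  rw [mul_comm]
  congr 1
  norm_cast
  rw [← map_mul, ← map_mul]
  exact quadraticChar_eq_of_mul_sq_eq (d := t * u * v) (e := 1) (by positivity) one_ne_zero
    (by field_simp)

theorem card_sq_mul_gauss3F2phi {t : F} (ht : t ≠ 0) :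
    (Fintype.card F : ℂ) ^ 2 * gauss3F2phi t
      = (∑ u, ∑ v, quadraticChar F (u * (u - 1) * v * (v - 1) * (1 - t * u * v)) : ℤ) := by
  have h0 : (Fintype.card F : ℂ) ≠ 0 := by simp
  have h1 : (Fintype.card F : ℂ) - 1 ≠ 0 := by
    rw [sub_ne_zero]
    exact_mod_cast Fintype.one_lt_card.ne'
  have hcancel : ∀ z : ℂ, (Fintype.card F : ℂ) ^ 2 *
      (1 / ((Fintype.card F : ℂ) ^ 2 * ((Fintype.card F : ℂ) - 1)) *
        (((Fintype.card F : ℂ) - 1) * z)) = z := fun z => by field_simp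
  let : Fintype (MulChar F ℂ) := Fintype.ofFinite _
  rw [gauss3F2phi, sum_mulChar_jacobiSum_pow_three t ht, hcancel]

theorem one_add_sum_quadraticChar {a b : F} (ha : a ≠ 0) :
    1 + ∑ x, quadraticChar F (x * (x + a) * (x ^ 2 + b))
      = ∑ x, quadraticChar F ((1 + x) * (1 + b / a ^ 2 * x ^ 2)) := by
  have h : ∀ x, quadraticChar F ((1 + x) * (1 + b / a ^ 2 * x ^ 2))
      = (if x = 0 then 1 else 0)
        + quadraticChar F (a * x⁻¹ * (a * x⁻¹ + a) * ((a * x⁻¹) ^ 2 + b)) := by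
    intro x
    split_ifs with hx
    · simp [hx]
    · rw [zero_add]
      exact quadraticChar_eq_of_mul_sq_eq (d := a ^ 2) (e := x ^ 2) (by positivity) (by positivity)
        (by field_simp)
  simp_rw [h, Finset.sum_add_distrib]
  rw [sum_comp_mul_inv (fun x => quadraticChar F (x * (x + a) * (x ^ 2 + b))) ha]
  simp

end GaussHypergeometric

/-- Let `F = F_q` with `q` odd, `φ` its quadratic character, `a, b ∈ F_q^×`,
and set `λ = a²/b`; assume `λ ≠ −1`. Then
`(1 + ∑_{x} φ(x·(x+a)·(x²+b)))² = q + q²·φ(λ+1)·₃F₂(φ,φ,φ; ε,ε | λ/(λ+1))`. -/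
theorem square_char_sum_eq_3F2
    {F : Type*} [Field F] [Fintype F] [DecidableEq F]
    (hq : Odd (Fintype.card F)) (a b : F) (ha : a ≠ 0) (hb : b ≠ 0)
    (lam : F) (hlam : lam = a ^ 2 / b) (hlam' : lam ≠ -1) :
    (1 + ∑ x : F, (quadCharℂ F) (x * (x + a) * (x ^ 2 + b))) ^ 2 =
      (Fintype.card F : ℂ) + (Fintype.card F : ℂ) ^ 2 * (quadCharℂ F) (lam + 1) *
        gauss3F2phi (lam / (lam + 1)) := by
  have hF : ringChar F ≠ 2 := fun h => by
    have := FiniteField.even_card_of_char_two h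
    rw [Nat.odd_iff] at hq
    omega
  have hl0 : lam ≠ 0 := by rw [hlam]; positivity
  have hl1 : lam + 1 ≠ 0 := fun h => hlam' (eq_neg_of_add_eq_zero_left h)
  have hc : lam⁻¹ ≠ 0 := inv_ne_zero hl0
  have hk : 1 + lam⁻¹ ≠ 0 := by
    rw [show 1 + lam⁻¹ = (lam + 1) / lam by field_simp]
    positivity
  rw [mul_right_comm, card_sq_mul_gauss3F2phi (div_ne_zero hl0 hl1)]
  simp_rw [quadCharℂ_apply]
  norm_cast
  rw [one_add_sum_quadraticChar ha, show b / a ^ 2 = lam⁻¹ by rw [hlam, inv_div],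
    sq_sum_quadraticChar hF hc hk, mul_comm (∑ u, _)]
  simp_rw [Finset.mul_sum, ← map_mul]
  congr 1
  refine Finset.sum_congr rfl fun u _ => Finset.sum_congr rfl fun v _ => ?_
  exact quadraticChar_eq_of_mul_sq_eq hl0 one_ne_zero (by field_simp)
end

section
/- Let a, b ∈ F_q^× and set λ = a²/b; assume λ ≠ −1. Then the number of affine points #{(x,y) ∈ F_q × F_q : y² = (x² + a)(x⁴ + b)} equals q − 1 + φ(−b)·Σ_{x∈F_q} φ((x−1)·(x² + λ)) + φ(−a)·Σ_{x∈F_q} φ((x−1)·(x² + λ^{−1})). -/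
/-- Summing over squares weights each value `t` by its number of square roots. -/
theorem sum_comp_sq_eq_sum_quadraticChar {F : Type*} [Field F] [Fintype F] [DecidableEq F]
    (hF : ringChar F ≠ 2) (g : F → ℤ) :
    ∑ x : F, g (x ^ 2) = ∑ t : F, (quadraticChar F t + 1) * g t := by
  rw [← Finset.sum_fiberwise (s := Finset.univ) (g := fun x : F => x ^ 2)]
  refine Finset.sum_congr rfl fun t _ => ?_
  rw [← quadraticChar_card_sqrts hF t,
    Finset.sum_congr rfl fun x hx => by rw [(Finset.mem_filter.mp hx).2],
    Finset.sum_const, nsmul_eq_mul]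
  congr 3
  ext x
  simp

/-- The number of affine points of `y² = f(x)` is `q + ∑ φ(f(x))`. -/
theorem card_sq_eq_eq_card_add_sum {F : Type*} [Field F] [Fintype F] [DecidableEq F]
    (hF : ringChar F ≠ 2) (f : F → F) :
    ((Finset.univ.filter (fun P : F × F => P.2 ^ 2 = f P.1)).card : ℤ) =
      Fintype.card F + ∑ x : F, quadraticChar F (f x) := by
  have h (x : F) : ∑ y : F, (if y ^ 2 = f x then (1 : ℤ) else 0) = quadraticChar F (f x) + 1 := by
    rw [← quadraticChar_card_sqrts hF (f x), Finset.sum_boole]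
    congr 2
    ext y
    simp
  rw [← Finset.sum_boole, Fintype.sum_prod_type]
  simp only [h, Finset.sum_add_distrib, Finset.sum_const, Finset.card_univ, nsmul_eq_mul, mul_one]
  ring

theorem quadraticChar_mul_sq {F : Type*} [Field F] [Fintype F] [DecidableEq F]
    {c : F} (hc : c ≠ 0) (x : F) : quadraticChar F (x * c ^ 2) = quadraticChar F x := by
  rw [map_mul, quadraticChar_sq_one' hc, mul_one]

/-- The substitution `t = -a * s` in the sum attached to `(t + a) * (t² + b)`. -/
theorem sum_quadraticChar_cubic {F : Type*} [Field F] [Fintype F] [DecidableEq F]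
    {a b : F} (ha : a ≠ 0) :
    ∑ t : F, quadraticChar F ((t + a) * (t ^ 2 + b)) =
      quadraticChar F (-a) * ∑ x : F, quadraticChar F ((x - 1) * (x ^ 2 + (a ^ 2 / b)⁻¹)) := by
  have hscale : ∑ t : F, quadraticChar F ((t + a) * (t ^ 2 + b)) =
      ∑ s : F, quadraticChar F ((-a * s + a) * ((-a * s) ^ 2 + b)) :=
    (Equiv.sum_comp (Equiv.mulLeft₀ (-a) (neg_ne_zero.mpr ha)) _).symm
  rw [hscale, Finset.mul_sum]
  refine Finset.sum_congr rfl fun x _ => ?_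
  rw [← map_mul, ← quadraticChar_mul_sq ha (-a * _)]
  congr 1
  rw [inv_div]
  field_simp
  ring

/-- The substitution `t = -a / s` in the sum attached to `t * (t + a) * (t² + b)`. -/
theorem sum_quadraticChar_quartic {F : Type*} [Field F] [Fintype F] [DecidableEq F]
    {a b : F} (ha : a ≠ 0) (hb : b ≠ 0) :
    ∑ t : F, quadraticChar F (t * ((t + a) * (t ^ 2 + b))) =
      quadraticChar F (-b) * (∑ x : F, quadraticChar F ((x - 1) * (x ^ 2 + a ^ 2 / b))) - 1 := by
  have hinv : ∑ t : F, quadraticChar F (t * ((t + a) * (t ^ 2 + b))) =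
      ∑ s : F, quadraticChar F ((-a * s⁻¹) * ((-a * s⁻¹ + a) * ((-a * s⁻¹) ^ 2 + b))) :=
    (((Equiv.inv F).trans (Equiv.mulLeft₀ (-a) (neg_ne_zero.mpr ha))).sum_comp _).symm
  rw [hinv, Finset.mul_sum, Fintype.sum_eq_add_sum_compl 0, Fintype.sum_eq_add_sum_compl (0 : F)
      (fun x => quadraticChar F (-b) * quadraticChar F ((x - 1) * (x ^ 2 + a ^ 2 / b)))]
  have hzero : quadraticChar F (-b) * quadraticChar F ((0 - 1) * (0 ^ 2 + a ^ 2 / b)) = 1 := by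
    rw [← map_mul, ← quadraticChar_sq_one' ha]
    congr 1
    field_simp
    ring
  have hne : ∀ s ∈ ({0}ᶜ : Finset F),
      quadraticChar F ((-a * s⁻¹) * ((-a * s⁻¹ + a) * ((-a * s⁻¹) ^ 2 + b))) =
        quadraticChar F (-b) * quadraticChar F ((s - 1) * (s ^ 2 + a ^ 2 / b)) := by
    intro s hs
    have hs : s ≠ 0 := by simpa using hs
    rw [← map_mul, ← quadraticChar_mul_sq (div_ne_zero ha (pow_ne_zero 2 hs)) (-b * _)]
    congr 1
    field_simp
    ring
  rw [hzero, Finset.sum_congr rfl hne]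
  simp


/-- Let `F = F_q` with `q` odd and `φ` its quadratic character. Let
`a, b ∈ F_q^×`, set `λ = a²/b`, and assume `λ ≠ −1`. Then the number of affine points of
`y² = (x² + a)(x⁴ + b)` over `F_q` equals
`q − 1 + φ(−b)·∑_x φ((x−1)·(x² + λ)) + φ(−a)·∑_x φ((x−1)·(x² + λ⁻¹))`. -/
theorem affine_points_genus_two_curve
    {F : Type*} [Field F] [Fintype F] [DecidableEq F]
    (hq : Odd (Fintype.card F)) (a b : F) (ha : a ≠ 0) (hb : b ≠ 0)
    (lam : F) (hlam : lam = a ^ 2 / b) (hlam' : lam ≠ -1) :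
    (((Finset.univ.filter
          (fun P : F × F => P.2 ^ 2 = (P.1 ^ 2 + a) * (P.1 ^ 4 + b))).card : ℂ) =
      (Fintype.card F : ℂ) - 1 +
        ((quadraticChar F (-b) : ℤ) : ℂ) *
          (∑ x : F, ((quadraticChar F ((x - 1) * (x ^ 2 + lam)) : ℤ) : ℂ)) +
        ((quadraticChar F (-a) : ℤ) : ℂ) *
          (∑ x : F, ((quadraticChar F ((x - 1) * (x ^ 2 + lam⁻¹)) : ℤ) : ℂ))) := by
  subst hlam
  have hF : ringChar F ≠ 2 := fun h =>
    Nat.not_even_iff_odd.mpr hq (FiniteField.even_card_iff_char_two.mp h |> Nat.even_iff.mpr)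
  have hsum : ∑ x : F, quadraticChar F ((x ^ 2 + a) * (x ^ 4 + b)) =
      ∑ t : F, (quadraticChar F t + 1) * quadraticChar F ((t + a) * (t ^ 2 + b)) := by
    rw [← sum_comp_sq_eq_sum_quadraticChar hF
      (fun t => quadraticChar F ((t + a) * (t ^ 2 + b)))]
    simp only [← pow_mul, Nat.reduceMul]
  have hcard := card_sq_eq_eq_card_add_sum hF (fun x : F => (x ^ 2 + a) * (x ^ 4 + b))
  rw [hsum] at hcard
  simp only [add_mul, one_mul, Finset.sum_add_distrib] at hcard
  simp only [← map_mul, ← add_mul] at hcard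
  rw [sum_quadraticChar_quartic ha hb, sum_quadraticChar_cubic ha] at hcard
  have hcast := congrArg (Int.cast : ℤ → ℂ) hcard
  push_cast at hcast
  rw [hcast]
  ring
end
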